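/- arXiv:math/0501319 — 2 statements merged into one kernel-verified Lean document; each statement's English description precedes it below -/
import Mathlib

section
/- For every t ∈ ℝ and every (x,ξ) ∈ ℝⁿ × ℝⁿ one has x(t,x,ξ)·ξ(t,x,ξ) = x·ξ + 2t p(x,ξ) + f(t,x,ξ), where f(t,x,ξ) := x(t,x,ξ)·ξ(t,x,ξ) − x·ξ − 2t p(x,ξ) satisfies |f(t,x,ξ)| ≤ 4 ε A₁ |ξ|² |∫₀^t ⟨x(s,x,ξ)⟩^{−(1+σ₀)} ds| ≤ 4 ε A₁ |t| |ξ|². -/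
open MeasureTheory Set
open scoped BigOperators

noncomputable section

namespace Paper

/-- `ℝⁿ` with the Euclidean norm. -/
abbrev Eu (n : ℕ) := EuclideanSpace ℝ (Fin n)

/-- The Japanese bracket `⟨x⟩ = (1 + |x|²)^{1/2}`. -/
def jb {n : ℕ} (x : Eu n) : ℝ := Real.sqrt (1 + ‖x‖ ^ 2)

/-- `⟨t⟩ = (1 + t²)^{1/2}` for a real number `t`. -/
def jbr (t : ℝ) : ℝ := Real.sqrt (1 + t ^ 2)

/-- The dot product `x·ξ` on `ℝⁿ`. -/
def dotp {n : ℕ} (x ξ : Eu n) : ℝ := ∑ j, x j * ξ j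

/-- First-order partial derivative `∂/∂xᵢ`. -/
def pd {n : ℕ} (i : Fin n) (f : Eu n → ℝ) : Eu n → ℝ :=
  fun x => fderiv ℝ f x (EuclideanSpace.single i 1)

/-- The list of coordinate directions attached to a multi-index `γ`. -/
def mIdx {n : ℕ} (γ : Fin n → ℕ) : List (Fin n) :=
  (List.finRange n).foldr (fun i acc => List.replicate (γ i) i ++ acc) []

/-- The multi-index partial derivative `∂^γ` of a function on `ℝⁿ`. -/
def mderiv {n : ℕ} (γ : Fin n → ℕ) (f : Eu n → ℝ) : Eu n → ℝ :=
  (mIdx γ).foldr pd f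

/-- The order `|γ|` of a multi-index. -/
def mOrd {n : ℕ} (γ : Fin n → ℕ) : ℕ := ∑ i, γ i

/-- Partial derivative in the first group of variables of a function `f(x,ξ)`. -/
def pdX {n : ℕ} (i : Fin n) (f : Eu n → Eu n → ℝ) : Eu n → Eu n → ℝ :=
  fun x ξ => fderiv ℝ (fun y => f y ξ) x (EuclideanSpace.single i 1)

/-- Partial derivative in the second group of variables of a function `f(x,ξ)`. -/
def pdXi {n : ℕ} (i : Fin n) (f : Eu n → Eu n → ℝ) : Eu n → Eu n → ℝ :=
  fun x ξ => fderiv ℝ (fun η => f x η) ξ (EuclideanSpace.single i 1)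

/-- The mixed multi-index derivative `∂_x^A ∂_ξ^B` of a function `f(x,ξ)`. -/
def mderiv2 {n : ℕ} (A B : Fin n → ℕ) (f : Eu n → Eu n → ℝ) : Eu n → Eu n → ℝ :=
  (mIdx A).foldr pdX ((mIdx B).foldr pdXi f)

/-! ### Multi-indices of order zero and one -/

theorem mIdx_zero {n : ℕ} : mIdx (0 : Fin n → ℕ) = [] := by
  unfold mIdx
  induction List.finRange n with
  | nil => rfl
  | cons a L ih => simp

theorem mIdx_single {n : ℕ} (i : Fin n) : mIdx (Pi.single i 1) = [i] := by
  have key : ∀ L : List (Fin n), L.Nodup →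
      L.foldr (fun j acc => List.replicate ((Pi.single i 1 : Fin n → ℕ) j) j ++ acc) [] =
        if i ∈ L then [i] else [] := by
    intro L hL
    induction L with
    | nil => simp
    | cons a L ih =>
      obtain ⟨ha, hL⟩ := List.nodup_cons.1 hL
      rw [List.foldr_cons, ih hL]
      rcases eq_or_ne a i with rfl | h
      · simp [ha]
      · simp [h, h.symm]
  simpa [mIdx] using key _ (List.nodup_finRange n)

theorem mderiv_zero {n : ℕ} (f : Eu n → ℝ) : mderiv 0 f = f := by
  simp [mderiv, mIdx_zero]

theorem mderiv_single {n : ℕ} (i : Fin n) (f : Eu n → ℝ) :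
    mderiv (Pi.single i 1) f = pd i f := by
  simp [mderiv, mIdx_single]

theorem apply_zero_le_sum_antidiagonalTuple {n : ℕ} (F : (Fin n → ℕ) → ℝ) (hF : ∀ γ, 0 ≤ F γ) :
    F 0 ≤ ∑ γ ∈ Finset.Nat.antidiagonalTuple n 0, F γ :=
  Finset.single_le_sum (fun γ _ => hF γ) (by simp [Finset.Nat.mem_antidiagonalTuple])

theorem sum_single_le_sum_antidiagonalTuple {n : ℕ} (F : (Fin n → ℕ) → ℝ) (hF : ∀ γ, 0 ≤ F γ) :
    ∑ i, F (Pi.single i 1) ≤ ∑ γ ∈ Finset.Nat.antidiagonalTuple n 1, F γ := by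
  have hinj : Function.Injective (fun i : Fin n => (Pi.single i 1 : Fin n → ℕ)) := by
    intro i j h
    by_contra hij
    have := congrFun h i
    simp [hij] at this
  rw [← Finset.sum_image (f := F) (hinj.injOn (s := ↑(Finset.univ : Finset (Fin n))))]
  refine Finset.sum_le_sum_of_subset_of_nonneg ?_ (fun γ _ _ => hF γ)
  intro γ hγ
  obtain ⟨i, -, rfl⟩ := Finset.mem_image.1 hγ
  simp [Finset.Nat.mem_antidiagonalTuple]

/-! ### The Japanese bracket -/

theorem one_le_jb {n : ℕ} (x : Eu n) : 1 ≤ jb x := by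
  rw [jb, Real.one_le_sqrt]
  nlinarith [sq_nonneg ‖x‖]

theorem norm_le_jb {n : ℕ} (x : Eu n) : ‖x‖ ≤ jb x :=
  Real.le_sqrt_of_sq_le (by linarith)

theorem continuous_jb {n : ℕ} : Continuous (jb : Eu n → ℝ) := by
  unfold jb
  fun_prop

theorem continuous_jb_rpow {n : ℕ} (r : ℝ) : Continuous (fun x : Eu n => jb x ^ r) :=
  continuous_jb.rpow_const fun x => Or.inl (by linarith [one_le_jb x])

/-! ### Linear algebra and calculus in coordinates -/

theorem abs_apply_le_norm {n : ℕ} (v : Eu n) (j : Fin n) : |v j| ≤ ‖v‖ := by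
  simpa using PiLp.norm_apply_le v j

theorem map_eq_sum_single {n : ℕ} (L : Eu n →L[ℝ] ℝ) (v : Eu n) :
    L v = ∑ j, v j * L (EuclideanSpace.single j 1) := by
  conv_lhs => rw [← (EuclideanSpace.basisFun (Fin n) ℝ).sum_repr v]
  simp

theorem hasDerivAt_of_coord {n : ℕ} {X : ℝ → Eu n} {v : Fin n → ℝ} {t : ℝ}
    (h : ∀ j, HasDerivAt (fun s => X s j) (v j) t) :
    HasDerivAt X (WithLp.toLp 2 v) t := by
  have h' : HasDerivAt (fun s => (X s).ofLp) v t := hasDerivAt_pi.2 h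
  exact ((PiLp.continuousLinearEquiv 2 ℝ (fun _ : Fin n => ℝ)).symm.toContinuousLinearMap
    |>.hasFDerivAt.comp_hasDerivAt t h')

theorem abs_quadratic_le {n : ℕ} (c : Fin n → Fin n → ℝ) (ξ : Eu n) :
    |∑ j, ∑ k, c j k * ξ j * ξ k| ≤ (∑ j, ∑ k, |c j k|) * ‖ξ‖ ^ 2 := by
  rw [Finset.sum_mul]
  refine (Finset.abs_sum_le_sum_abs _ _).trans (Finset.sum_le_sum fun j _ => ?_)
  rw [Finset.sum_mul]
  refine (Finset.abs_sum_le_sum_abs _ _).trans (Finset.sum_le_sum fun k _ => ?_)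
  rw [abs_mul, abs_mul, mul_assoc, sq]
  gcongr <;> exact abs_apply_le_norm _ _

/-! ### Hamiltonian flows -/

theorem hasDerivAt_hamiltonian_zero {n : ℕ} {p : Eu n → Eu n → ℝ}
    (hp : Differentiable ℝ (fun z : Eu n × Eu n => p z.1 z.2)) {X Ξ : ℝ → Eu n} {t : ℝ}
    (hX : ∀ j, HasDerivAt (fun s => X s j)
      (fderiv ℝ (fun η => p (X t) η) (Ξ t) (EuclideanSpace.single j 1)) t)
    (hΞ : ∀ j, HasDerivAt (fun s => Ξ s j)
      (-(fderiv ℝ (fun y => p y (Ξ t)) (X t) (EuclideanSpace.single j 1))) t) :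
    HasDerivAt (fun s => p (X s) (Ξ s)) 0 t := by
  have hP := (hp (X t, Ξ t)).hasFDerivAt
  have h₁ : HasFDerivAt (fun y => p y (Ξ t)) _ (X t) :=
    HasFDerivAt.comp (X t) (f := fun y => (y, Ξ t)) hP (hasFDerivAt_prodMk_left (X t) (Ξ t))
  have h₂ : HasFDerivAt (fun η => p (X t) η) _ (Ξ t) :=
    HasFDerivAt.comp (Ξ t) (f := fun η => (X t, η)) hP (hasFDerivAt_prodMk_right (X t) (Ξ t))
  have h := HasFDerivAt.comp_hasDerivAt t (f := fun s => (X s, Ξ s)) hP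
    ((hasDerivAt_of_coord hX).prodMk (hasDerivAt_of_coord hΞ))
  refine h.congr_deriv ?_
  set L := fderiv ℝ (fun z : Eu n × Eu n => p z.1 z.2) (X t, Ξ t) with hL
  have split : ∀ u v : Eu n, L (u, v) =
      (L.comp (ContinuousLinearMap.inl ℝ _ _)) u + (L.comp (ContinuousLinearMap.inr ℝ _ _)) v := by
    intro u v
    simp [← map_add]
  rw [split, map_eq_sum_single, map_eq_sum_single (L.comp (ContinuousLinearMap.inr ℝ _ _)),
    h₁.fderiv, h₂.fderiv, ← Finset.sum_add_distrib]
  exact Finset.sum_eq_zero fun j _ => by ring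

theorem hasDerivAt_dotp_hamiltonian {n : ℕ} {p : Eu n → Eu n → ℝ} {X Ξ : ℝ → Eu n} {t : ℝ}
    (hX : ∀ j, HasDerivAt (fun s => X s j)
      (fderiv ℝ (fun η => p (X t) η) (Ξ t) (EuclideanSpace.single j 1)) t)
    (hΞ : ∀ j, HasDerivAt (fun s => Ξ s j)
      (-(fderiv ℝ (fun y => p y (Ξ t)) (X t) (EuclideanSpace.single j 1))) t) :
    HasDerivAt (fun s => dotp (X s) (Ξ s))
      (fderiv ℝ (fun η => p (X t) η) (Ξ t) (Ξ t) - fderiv ℝ (fun y => p y (Ξ t)) (X t) (X t)) t := by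
  have h := HasDerivAt.fun_sum (u := Finset.univ) fun j _ => (hX j).mul (hΞ j)
  refine h.congr_deriv ?_
  rw [map_eq_sum_single, map_eq_sum_single (fderiv ℝ (fun y => p y (Ξ t)) (X t)),
    ← Finset.sum_sub_distrib]
  exact Finset.sum_congr rfl fun j _ => by ring

theorem fderiv_apply_self_of_homogeneous_two {E : Type*} [NormedAddCommGroup E] [NormedSpace ℝ E]
    {f : E → ℝ} (hf : ∀ (s : ℝ) v, f (s • v) = s ^ 2 * f v) {v : E}
    (hd : DifferentiableAt ℝ f v) : fderiv ℝ f v v = 2 * f v := by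
  have h₁ : HasDerivAt (fun s : ℝ => f (s • v)) (fderiv ℝ f v v) 1 := by
    have hs : HasDerivAt (fun s : ℝ => s • v) v 1 := by
      simpa using (hasDerivAt_id (1 : ℝ)).smul_const v
    exact HasFDerivAt.comp_hasDerivAt 1 (by simpa using hd.hasFDerivAt) hs
  have h₂ : HasDerivAt (fun s : ℝ => f (s • v)) (2 * f v) 1 := by
    simp only [hf]
    simpa using (hasDerivAt_pow 2 (1 : ℝ)).mul_const (f v)
  exact h₁.unique h₂

/-! ### The metric symbol -/

section Symbol

variable {n : ℕ} {b : Fin n → Fin n → Eu n → ℝ} {p : Eu n → Eu n → ℝ} {ε : ℝ}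

theorem differentiable_symbol (hb : ∀ j k, Differentiable ℝ (b j k))
    (hp : ∀ x ξ, p x ξ = ‖ξ‖ ^ 2 + ε * ∑ j, ∑ k, b j k x * ξ j * ξ k) :
    Differentiable ℝ (fun z : Eu n × Eu n => p z.1 z.2) := by
  simp only [hp]
  have hn : Differentiable ℝ (fun z : Eu n × Eu n => ‖z.2‖ ^ 2) :=
    differentiable_snd.norm_sq ℝ
  have hc : ∀ j, Differentiable ℝ (fun z : Eu n × Eu n => z.2 j) := fun j =>
    (EuclideanSpace.proj (𝕜 := ℝ) j).differentiable.comp differentiable_snd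
  have hb' : ∀ j k, Differentiable ℝ (fun z : Eu n × Eu n => b j k z.1) := fun j k =>
    (hb j k).comp differentiable_fst
  fun_prop

theorem symbol_smul (hp : ∀ x ξ, p x ξ = ‖ξ‖ ^ 2 + ε * ∑ j, ∑ k, b j k x * ξ j * ξ k)
    (x : Eu n) (s : ℝ) (ξ : Eu n) : p x (s • ξ) = s ^ 2 * p x ξ := by
  simp only [hp, norm_smul, mul_pow, Real.norm_eq_abs, sq_abs, mul_add, Finset.mul_sum,
    PiLp.smul_apply, smul_eq_mul]
  congr 1
  refine Finset.sum_congr rfl fun j _ => Finset.sum_congr rfl fun k _ => ?_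
  ring

theorem fderiv_symbol_left_apply (hb : ∀ j k, Differentiable ℝ (b j k))
    (hp : ∀ x ξ, p x ξ = ‖ξ‖ ^ 2 + ε * ∑ j, ∑ k, b j k x * ξ j * ξ k) (x ξ v : Eu n) :
    fderiv ℝ (fun y => p y ξ) x v =
      ε * ∑ j, ∑ k, fderiv ℝ (b j k) x v * ξ j * ξ k := by
  have h : HasFDerivAt (fun y => p y ξ)
      (ε • ∑ j, ∑ k, (ξ k) • (ξ j) • fderiv ℝ (b j k) x) x := by
    simp only [hp]
    refine HasFDerivAt.const_add _ (HasFDerivAt.const_mul ?_ ε)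
    exact HasFDerivAt.fun_sum fun j _ => HasFDerivAt.fun_sum fun k _ =>
      ((hb j k x).hasFDerivAt.mul_const (ξ j)).mul_const (ξ k)
  rw [h.fderiv]
  simp only [smul_apply, sum_apply, smul_eq_mul]
  congr 1
  refine Finset.sum_congr rfl fun j _ => Finset.sum_congr rfl fun k _ => ?_
  ring

theorem abs_symbol_sub_le {A₀ σ : ℝ} (hσ : 0 < σ) (hA₀ : 0 < A₀) (hε : 0 < ε)
    (hbound : ∀ x : Eu n, ∑ j, ∑ k, |b j k x| ≤ A₀ * jb x ^ (-(1 + σ)))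
    (hp : ∀ x ξ, p x ξ = ‖ξ‖ ^ 2 + ε * ∑ j, ∑ k, b j k x * ξ j * ξ k) (x ξ : Eu n) :
    |p x ξ - ‖ξ‖ ^ 2| ≤ ε * A₀ * ‖ξ‖ ^ 2 := by
  have h1 : jb x ^ (-(1 + σ)) ≤ 1 :=
    Real.rpow_le_one_of_one_le_of_nonpos (one_le_jb x) (by linarith)
  rw [hp, add_sub_cancel_left, abs_mul, abs_of_pos hε, mul_assoc]
  gcongr
  refine (abs_quadratic_le (fun j k => b j k x) ξ).trans ?_
  gcongr
  exact (hbound x).trans (mul_le_of_le_one_right hA₀.le h1)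

theorem abs_fderiv_symbol_left_self_le {A₁ σ : ℝ} (hε : 0 < ε)
    (hb : ∀ j k, Differentiable ℝ (b j k))
    (hbound : ∀ x : Eu n, ∑ i, ∑ j, ∑ k, |pd i (b j k) x| ≤ A₁ * jb x ^ (-(2 + σ)))
    (hp : ∀ x ξ, p x ξ = ‖ξ‖ ^ 2 + ε * ∑ j, ∑ k, b j k x * ξ j * ξ k) (x ξ : Eu n) :
    |fderiv ℝ (fun y => p y ξ) x x| ≤ ε * A₁ * jb x ^ (-(1 + σ)) * ‖ξ‖ ^ 2 := by
  have hpos : 0 < jb x := by linarith [one_le_jb x]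
  rw [fderiv_symbol_left_apply hb hp, abs_mul, abs_of_pos hε, mul_assoc, mul_assoc]
  gcongr
  refine (abs_quadratic_le (fun j k => fderiv ℝ (b j k) x x) ξ).trans ?_
  rw [← mul_assoc]
  gcongr
  have hsum : ∑ j, ∑ k, |fderiv ℝ (b j k) x x| ≤ jb x * ∑ i, ∑ j, ∑ k, |pd i (b j k) x| := by
    calc ∑ j, ∑ k, |fderiv ℝ (b j k) x x|
        ≤ ∑ j, ∑ k, ∑ i, jb x * |pd i (b j k) x| := by
          refine Finset.sum_le_sum fun j _ => Finset.sum_le_sum fun k _ => ?_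
          rw [map_eq_sum_single]
          refine (Finset.abs_sum_le_sum_abs _ _).trans (Finset.sum_le_sum fun i _ => ?_)
          rw [abs_mul]
          exact mul_le_mul_of_nonneg_right ((abs_apply_le_norm x i).trans (norm_le_jb x))
            (abs_nonneg _)
      _ = jb x * ∑ i, ∑ j, ∑ k, |pd i (b j k) x| := by
          simp only [← Finset.mul_sum]
          congr 1
          rw [Finset.sum_comm (s := (Finset.univ : Finset (Fin n)))
            (f := fun i j => ∑ k, |pd i (b j k) x|)]
          exact Finset.sum_congr rfl fun j _ => Finset.sum_comm
  calc _ ≤ jb x * (A₁ * jb x ^ (-(2 + σ))) := hsum.trans (by gcongr; exact hbound x)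
    _ = A₁ * (jb x ^ (1 : ℝ) * jb x ^ (-(2 + σ))) := by rw [Real.rpow_one]; ring
    _ = A₁ * jb x ^ (-(1 + σ)) := by
      rw [← Real.rpow_add hpos]
      ring_nf

end Symbol

/-- **Lemma III.1.1.** For the bicharacteristic flow `(x(t,x,ξ), ξ(t,x,ξ))` of
`p(x,ξ) = |ξ|² + ε q(x,ξ)` one has
`x(t,x,ξ)·ξ(t,x,ξ) = x·ξ + 2t p(x,ξ) + f(t,x,ξ)` with
`|f(t,x,ξ)| ≤ 4εA₁|ξ|² |∫₀ᵗ ⟨x(s,x,ξ)⟩^{−(1+σ₀)} ds| ≤ 4εA₁|t||ξ|²`. -/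
theorem statement2
    (n : ℕ) (hn : 1 ≤ n) (σ₀ : ℝ) (hσ₀ : 0 < σ₀) (hσ₀' : σ₀ < 1)
    (b : Fin n → Fin n → Eu n → ℝ)
    (hbsmooth : ∀ j k, ContDiff ℝ (⊤ : ℕ∞) (b j k))
    (A : ℕ → ℝ) (hApos : ∀ ℓ, 0 < A ℓ)
    (hbbound : ∀ (ℓ : ℕ) (x : Eu n),
      (∑ γ ∈ Finset.Nat.antidiagonalTuple n ℓ, ∑ j, ∑ k, |mderiv γ (b j k) x|) ≤
        A ℓ * jb x ^ (-(1 + (ℓ : ℝ) + σ₀)))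
    (ε : ℝ) (hε : 0 < ε) (hεA : ε * A 0 ≤ 1 / 10)
    (p : Eu n → Eu n → ℝ)
    (hp : ∀ x ξ, p x ξ = ‖ξ‖ ^ 2 + ε * ∑ j, ∑ k, b j k x * ξ j * ξ k)
    (Xf Ξf : ℝ → Eu n → Eu n → Eu n)
    (hsmooth : ContDiff ℝ (⊤ : ℕ∞)
      (fun q : ℝ × Eu n × Eu n => (Xf q.1 q.2.1 q.2.2, Ξf q.1 q.2.1 q.2.2)))
    (hflowX : ∀ (t : ℝ) (x ξ : Eu n) (j : Fin n),
      HasDerivAt (fun s => Xf s x ξ j)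
        (fderiv ℝ (fun η => p (Xf t x ξ) η) (Ξf t x ξ) (EuclideanSpace.single j 1)) t)
    (hflowΞ : ∀ (t : ℝ) (x ξ : Eu n) (j : Fin n),
      HasDerivAt (fun s => Ξf s x ξ j)
        (-(fderiv ℝ (fun y => p y (Ξf t x ξ)) (Xf t x ξ) (EuclideanSpace.single j 1))) t)
    (hX0 : ∀ x ξ, Xf 0 x ξ = x) (hΞ0 : ∀ x ξ, Ξf 0 x ξ = ξ) :
    ∀ (t : ℝ) (x ξ : Eu n),
      |dotp (Xf t x ξ) (Ξf t x ξ) - dotp x ξ - 2 * t * p x ξ| ≤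
          4 * ε * A 1 * ‖ξ‖ ^ 2 * |∫ s in (0:ℝ)..t, jb (Xf s x ξ) ^ (-(1 + σ₀))| ∧
        4 * ε * A 1 * ‖ξ‖ ^ 2 * |∫ s in (0:ℝ)..t, jb (Xf s x ξ) ^ (-(1 + σ₀))| ≤
          4 * ε * A 1 * |t| * ‖ξ‖ ^ 2 := by
  intro t x ξ
  have hdiff : ∀ j k, Differentiable ℝ (b j k) := fun j k =>
    (hbsmooth j k).differentiable (by simp)
  have hb₀ : ∀ y : Eu n, ∑ j, ∑ k, |b j k y| ≤ A 0 * jb y ^ (-(1 + σ₀)) := fun y => by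
    have h := (apply_zero_le_sum_antidiagonalTuple
      (fun γ => ∑ j, ∑ k, |mderiv γ (b j k) y|) fun γ => by positivity).trans (hbbound 0 y)
    simpa [mderiv_zero] using h
  have hb₁ : ∀ y : Eu n, ∑ i, ∑ j, ∑ k, |pd i (b j k) y| ≤ A 1 * jb y ^ (-(2 + σ₀)) := fun y => by
    have h := (sum_single_le_sum_antidiagonalTuple
      (fun γ => ∑ j, ∑ k, |mderiv γ (b j k) y|) fun γ => by positivity).trans (hbbound 1 y)
    simp only [mderiv_single] at h
    rwa [show (1 : ℝ) + ((1 : ℕ) : ℝ) + σ₀ = 2 + σ₀ by norm_num] at h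
  have hP := differentiable_symbol hdiff hp
  have hcX : Continuous (fun s => Xf s x ξ) := hsmooth.continuous.fst.comp
    (continuous_id.prodMk (continuous_const (y := (x, ξ))))
  have hcΞ : Continuous (fun s => Ξf s x ξ) := hsmooth.continuous.snd.comp
    (continuous_id.prodMk (continuous_const (y := (x, ξ))))
  have hconst : ∀ s, p (Xf s x ξ) (Ξf s x ξ) = p x ξ := fun s => by
    have h := fun s => hasDerivAt_hamiltonian_zero hP (X := fun s => Xf s x ξ)
      (Ξ := fun s => Ξf s x ξ) (hflowX s x ξ) (hflowΞ s x ξ)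
    have := is_const_of_deriv_eq_zero (fun s => (h s).differentiableAt) (fun s => (h s).deriv) s 0
    simpa [hX0, hΞ0] using this
  have helliptic : ∀ y η : Eu n, |p y η - ‖η‖ ^ 2| ≤ 1 / 10 * ‖η‖ ^ 2 := fun y η =>
    (abs_symbol_sub_le hσ₀ (hApos 0) hε hb₀ hp y η).trans (by gcongr)
  have hΞbound : ∀ s, ‖Ξf s x ξ‖ ^ 2 ≤ 4 * ‖ξ‖ ^ 2 := fun s => by
    have h₁ := abs_le.1 (helliptic (Xf s x ξ) (Ξf s x ξ))
    have h₂ := abs_le.1 (helliptic x ξ)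
    rw [hconst] at h₁
    nlinarith [sq_nonneg ‖ξ‖]
  set g : ℝ → ℝ := fun s => jb (Xf s x ξ) ^ (-(1 + σ₀)) with hg
  have hgc : Continuous g := (continuous_jb_rpow _).comp hcX
  have hg0 : ∀ s, 0 ≤ g s := fun s => Real.rpow_nonneg (Real.sqrt_nonneg _) _
  have hA₁ := hApos 1
  set f' : ℝ → ℝ := fun s => fderiv ℝ (fun y => p y (Ξf s x ξ)) (Xf s x ξ) (Xf s x ξ) with hf'
  have hf'c : Continuous f' := by
    simp only [hf', fderiv_symbol_left_apply hdiff hp]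
    have hc : ∀ j, Continuous (fun s => Ξf s x ξ j) := fun j =>
      (EuclideanSpace.proj (𝕜 := ℝ) j).continuous.comp hcΞ
    have hd : ∀ j k, Continuous (fun s => fderiv ℝ (b j k) (Xf s x ξ) (Xf s x ξ)) := fun j k =>
      (((hbsmooth j k).continuous_fderiv (by simp)).comp hcX).clm_apply hcX
    fun_prop
  have hderiv : ∀ s, HasDerivAt
      (fun s => dotp (Xf s x ξ) (Ξf s x ξ) - 2 * s * p x ξ) (-f' s) s := fun s => by
    have h := hasDerivAt_dotp_hamiltonian (X := fun s => Xf s x ξ) (Ξ := fun s => Ξf s x ξ)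
      (hflowX s x ξ) (hflowΞ s x ξ)
    have hEuler : fderiv ℝ (fun η => p (Xf s x ξ) η) (Ξf s x ξ) (Ξf s x ξ) = 2 * p x ξ := by
      rw [fderiv_apply_self_of_homogeneous_two (symbol_smul hp _), hconst]
      exact (hP.comp ((differentiable_const (Xf s x ξ)).prodMk differentiable_id)) _
    refine (h.sub (((hasDerivAt_id s).const_mul 2).mul_const (p x ξ))).congr_deriv ?_
    simp only [hEuler, hf']
    ring
  have hf'g : ∀ s, ‖-f' s‖ ≤ 4 * ε * A 1 * ‖ξ‖ ^ 2 * g s := fun s => by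
    rw [norm_neg, Real.norm_eq_abs]
    calc |f' s| ≤ ε * A 1 * g s * ‖Ξf s x ξ‖ ^ 2 :=
          abs_fderiv_symbol_left_self_le hε hdiff hb₁ hp _ _
      _ ≤ ε * A 1 * g s * (4 * ‖ξ‖ ^ 2) :=
          mul_le_mul_of_nonneg_left (hΞbound s) (by have := hg0 s; positivity)
      _ = _ := by ring
  constructor
  · have hFTC := intervalIntegral.integral_eq_sub_of_hasDerivAt (a := 0) (b := t)
      (fun s _ => hderiv s) (hf'c.neg.intervalIntegrable _ _)
    have hle := intervalIntegral.norm_integral_le_abs_of_norm_le (μ := volume) (a := 0) (b := t)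
      (Filter.Eventually.of_forall hf'g)
      ((hgc.const_mul (4 * ε * A 1 * ‖ξ‖ ^ 2)).intervalIntegrable _ _)
    rw [hFTC, Real.norm_eq_abs, intervalIntegral.integral_const_mul, abs_mul,
      abs_of_nonneg (by positivity : 0 ≤ 4 * ε * A 1 * ‖ξ‖ ^ 2)] at hle
    simp only [hX0, hΞ0] at hle
    convert hle using 2
    ring
  · have hint : |∫ s in (0:ℝ)..t, g s| ≤ |t| := by
      have := intervalIntegral.norm_integral_le_of_norm_le_const (a := 0) (b := t) (f := g) (C := 1)
        fun s _ => by
          rw [Real.norm_eq_abs, abs_of_nonneg (hg0 s)]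
          exact Real.rpow_le_one_of_one_le_of_nonpos (one_le_jb _) (by linarith)
      simpa using this
    calc _ ≤ 4 * ε * A 1 * ‖ξ‖ ^ 2 * |t| := by gcongr
      _ = _ := by ring

end Paper
end
end

section
/- Define r(t,x,ξ) = x(t,x,ξ) − (x + 2tξ) and ζ(t,x,ξ) = ξ(t,x,ξ) − ξ. Let T > 0. Then for all multi-indices A, B ∈ ℕⁿ there is a constant C_{A,B} > 0 (depending only on T, A, B, n, σ₀ and the constants A_ℓ, but not on ε) such that for Z ∈ {r, ζ}, for all |t| ≤ T, all x ∈ ℝⁿ and all ξ ∈ ℝⁿ with |ξ| ≤ 3: (i) |∂_x^A ∂_ξ^B Z(t,x,ξ)| ≤ C_{A,B} ε |t|, and (ii) |∂_t ∂_x^A ∂_ξ^B Z(t,x,ξ)| ≤ C_{A,B} ε. -/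
open MeasureTheory Set
open scoped BigOperators

noncomputable section

namespace Paper

set_option maxSynthPendingDepth 3

section JetBounds

variable {E F G H : Type} [NormedAddCommGroup E] [NormedSpace ℝ E]
  [NormedAddCommGroup F] [NormedSpace ℝ F] [NormedAddCommGroup G] [NormedSpace ℝ G]
  [NormedAddCommGroup H] [NormedSpace ℝ H]

/-- All derivatives of `f` at `z` up to order `k` have norm at most `K`. -/
def JetBound (k : ℕ) (f : E → F) (z : E) (K : ℝ) : Prop :=
  ∀ i ≤ k, ‖iteratedFDeriv ℝ i f z‖ ≤ K

lemma natCast_le_smooth (i : ℕ) : (i : WithTop ℕ∞) ≤ ((⊤ : ℕ∞) : WithTop ℕ∞) := by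
  exact_mod_cast le_top

lemma smooth_le_smooth_add_one :
    ((⊤ : ℕ∞) : WithTop ℕ∞) + 1 ≤ ((⊤ : ℕ∞) : WithTop ℕ∞) := le_rfl

lemma smooth_fderiv {f : E → F} (hf : ContDiff ℝ (⊤ : ℕ∞) f) :
    ContDiff ℝ (⊤ : ℕ∞) (fderiv ℝ f) :=
  hf.fderiv_right smooth_le_smooth_add_one

namespace JetBound

variable {k : ℕ} {f g : E → F} {z : E} {K K' : ℝ}

lemma norm_le (h : JetBound k f z K) : ‖f z‖ ≤ K := by
  simpa using h 0 (Nat.zero_le k)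

lemma nonneg (h : JetBound k f z K) : 0 ≤ K := (norm_nonneg _).trans h.norm_le

lemma of_norm_le (h : ‖f z‖ ≤ K) : JetBound 0 f z K := by
  intro i hi
  obtain rfl : i = 0 := by omega
  simpa using h

lemma mono (h : JetBound k f z K) (hK : K ≤ K') : JetBound k f z K' :=
  fun i hi => (h i hi).trans hK

lemma mono_order {m : ℕ} (h : JetBound k f z K) (hm : m ≤ k) : JetBound m f z K :=
  fun i hi => h i (hi.trans hm)

lemma fderiv (h : JetBound (k + 1) f z K) : JetBound k (fderiv ℝ f) z K := by
  intro i hi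
  rw [norm_iteratedFDeriv_fderiv]
  exact h _ (by omega)

lemma of_fderiv (h0 : ‖f z‖ ≤ K) (h : JetBound k (_root_.fderiv ℝ f) z K) :
    JetBound (k + 1) f z K := by
  intro i hi
  cases i with
  | zero => simpa using h0
  | succ i =>
    rw [← norm_iteratedFDeriv_fderiv]
    exact h i (by omega)

lemma add (hf : ContDiff ℝ (⊤ : ℕ∞) f) (hg : ContDiff ℝ (⊤ : ℕ∞) g)
    (h : JetBound k f z K) (h' : JetBound k g z K') :
    JetBound k (fun y => f y + g y) z (K + K') := by
  intro i hi
  have e : (fun y => f y + g y) = f + g := rfl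
  rw [e, iteratedFDeriv_add_apply (hf.of_le (natCast_le_smooth i)).contDiffAt
    (hg.of_le (natCast_le_smooth i)).contDiffAt]
  exact (norm_add_le _ _).trans (add_le_add (h i hi) (h' i hi))

lemma sum {ι : Type} {s : Finset ι} {f : ι → E → F} {K : ι → ℝ}
    (hf : ∀ a ∈ s, ContDiff ℝ (⊤ : ℕ∞) (f a)) (h : ∀ a ∈ s, JetBound k (f a) z (K a)) :
    JetBound k (fun y => ∑ a ∈ s, f a y) z (∑ a ∈ s, K a) := by
  intro i hi
  rw [iteratedFDeriv_sum (fun a ha => (hf a ha).of_le (natCast_le_smooth i)), Finset.sum_apply]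
  exact (norm_sum_le _ _).trans (Finset.sum_le_sum fun a ha => h a ha i hi)

lemma clm_comp (L : F →L[ℝ] G) (hf : ContDiff ℝ (⊤ : ℕ∞) f) (h : JetBound k f z K) :
    JetBound k (fun y => L (f y)) z (‖L‖ * K) := by
  intro i hi
  exact (L.norm_iteratedFDeriv_comp_left hf.contDiffAt (natCast_le_smooth i)).trans
    (mul_le_mul_of_nonneg_left (h i hi) (norm_nonneg _))

lemma const_smul (c : ℝ) (hf : ContDiff ℝ (⊤ : ℕ∞) f) (h : JetBound k f z K) :
    JetBound k (fun y => c • f y) z (|c| * K) := by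
  intro i hi
  have e : (fun y => c • f y) = c • f := rfl
  rw [e, iteratedFDeriv_const_smul_apply (hf.of_le (natCast_le_smooth i)).contDiffAt, norm_smul]
  exact mul_le_mul_of_nonneg_left (h i hi) (norm_nonneg _)

lemma const (c : F) (hc : ‖c‖ ≤ K) : JetBound k (fun _ : E => c) z K := by
  intro i _
  cases i with
  | zero => simpa using hc
  | succ i =>
    rw [iteratedFDeriv_const_of_ne (Nat.succ_ne_zero i)]
    simpa using (norm_nonneg _).trans hc

lemma clm (L : E →L[ℝ] F) (hL : ‖L‖ ≤ K) (hz : ‖L z‖ ≤ K) : JetBound k (fun y => L y) z K := by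
  refine JetBound.mono_order (of_fderiv (k := k) hz ?_) (Nat.le_succ k)
  have e : _root_.fderiv ℝ (fun y => L y) = fun _ => L := by
    ext1 y; exact L.fderiv
  rw [e]
  exact const L hL

lemma bilinear (B : F →L[ℝ] G →L[ℝ] H) (hB : ‖B‖ ≤ 1) {g : E → G}
    (hf : ContDiff ℝ (⊤ : ℕ∞) f) (hg : ContDiff ℝ (⊤ : ℕ∞) g)
    (h : JetBound k f z K) (h' : JetBound k g z K') :
    JetBound k (fun y => B (f y) (g y)) z (2 ^ k * K * K') := by
  intro i hi
  have hK := h.nonneg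
  have hK' := h'.nonneg
  calc _ ≤ _ := B.norm_iteratedFDeriv_le_of_bilinear_of_le_one hf hg z (natCast_le_smooth i) hB
    _ ≤ ∑ m ∈ Finset.range (i + 1), (i.choose m : ℝ) * K * K' := by
      refine Finset.sum_le_sum fun m hm => ?_
      have hm : m ≤ i := by simpa [Nat.lt_succ_iff] using hm
      gcongr
      · exact h m (hm.trans hi)
      · exact h' _ ((Nat.sub_le _ _).trans hi)
    _ = 2 ^ i * K * K' := by
      rw [← Finset.sum_mul, ← Finset.sum_mul]
      congr 2
      exact_mod_cast Nat.sum_range_choose i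
    _ ≤ 2 ^ k * K * K' := by
      gcongr
      norm_num

lemma comp {g : F → G} (hg : ContDiff ℝ (⊤ : ℕ∞) g) (hf : ContDiff ℝ (⊤ : ℕ∞) f)
    (h : JetBound k g (f z) K) (hK' : 1 ≤ K')
    (h' : ∀ i, 1 ≤ i → i ≤ k → ‖iteratedFDeriv ℝ i f z‖ ≤ K') :
    JetBound k (fun y => g (f y)) z (k.factorial * K * K' ^ k) := by
  intro i hi
  have hK := h.nonneg
  refine (norm_iteratedFDeriv_comp_le (D := K') hg hf (natCast_le_smooth i) z
    (fun m hm => h m (hm.trans hi)) fun m hm hm' =>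
      (h' m hm (hm'.trans hi)).trans (le_self_pow₀ hK' (by omega))).trans ?_
  gcongr

lemma comp_clm_add {g : F → G} {Z : E → F} {Λ : ℝ} (hg : ContDiff ℝ (⊤ : ℕ∞) g)
    (L : E →L[ℝ] F) (hZ : ContDiff ℝ (⊤ : ℕ∞) Z) (h : JetBound k g (L z + Z z) K)
    (hΛ : ‖L‖ ≤ Λ) (h' : JetBound k Z z K') :
    JetBound k (fun y => g (L y + Z y)) z (k.factorial * K * (Λ + K' + 1) ^ k) := by
  have hK' := h'.nonneg
  have hΛ0 := (norm_nonneg _).trans hΛ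
  refine comp (f := fun y => L y + Z y) hg (L.contDiff.add hZ) h (by linarith) ?_
  intro i hi hik
  have hLi : ‖iteratedFDeriv ℝ i (fun y => L y) z‖ ≤ Λ := by
    obtain ⟨i, rfl⟩ : ∃ m, i = m + 1 := ⟨i - 1, by omega⟩
    rw [← norm_iteratedFDeriv_fderiv]
    have e : _root_.fderiv ℝ (fun y => L y) = fun _ => L := funext fun y => L.fderiv
    rw [e]
    exact const L hΛ i le_rfl
  have e : (fun y => L y + Z y) = (fun y => L y) + Z := rfl
  rw [e, iteratedFDeriv_add_apply L.contDiff.contDiffAt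
    (hZ.of_le (natCast_le_smooth i)).contDiffAt]
  exact (norm_add_le _ _).trans (by linarith [h' i hik])

end JetBound

/-- Grönwall's inequality with zero initial data, forward in time. -/
lemma norm_le_of_norm_deriv_le_forward {T K δ : ℝ} (hK : 0 < K) (hδ : 0 ≤ δ) {w w' : ℝ → G}
    (hw : ∀ t, HasDerivAt w (w' t) t) (h0 : w 0 = 0)
    (h : ∀ t, 0 ≤ t → t ≤ T → ‖w' t‖ ≤ K * ‖w t‖ + δ) {t : ℝ} (ht : 0 ≤ t) (htT : t ≤ T) :
    ‖w t‖ ≤ Real.exp (K * T) * δ * t := by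
  have h1 := norm_le_gronwallBound_of_norm_deriv_right_le (f := w) (f' := w') (δ := 0) (K := K)
    (ε := δ) (a := 0) (b := T) (fun s _ => (hw s).continuousAt.continuousWithinAt)
    (fun s _ => (hw s).hasDerivWithinAt) (by simp [h0]) (fun s hs => h s hs.1 hs.2.le)
    t ⟨ht, htT⟩
  rw [gronwallBound_of_K_ne_0 hK.ne'] at h1
  simp only [zero_mul, zero_add, sub_zero] at h1
  have h2 : Real.exp (K * t) - 1 ≤ K * t * Real.exp (K * t) := by
    have h3 := Real.add_one_le_exp (-(K * t))
    have h4 : Real.exp (-(K * t)) * Real.exp (K * t) = 1 := by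
      rw [← Real.exp_add]; simp
    nlinarith [Real.exp_pos (K * t)]
  have h3 : Real.exp (K * t) ≤ Real.exp (K * T) := Real.exp_le_exp.2 (by gcongr)
  calc ‖w t‖ ≤ δ / K * (K * t * Real.exp (K * t)) := h1.trans (by gcongr)
    _ = Real.exp (K * t) * δ * t := by field_simp
    _ ≤ _ := by gcongr

/-- Grönwall's inequality with zero initial data, in both time directions. -/
lemma norm_le_of_norm_deriv_le {T K δ : ℝ} (hK : 0 < K) (hδ : 0 ≤ δ) {w w' : ℝ → G}
    (hw : ∀ t, HasDerivAt w (w' t) t) (h0 : w 0 = 0)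
    (h : ∀ t, |t| ≤ T → ‖w' t‖ ≤ K * ‖w t‖ + δ) {t : ℝ} (htT : |t| ≤ T) :
    ‖w t‖ ≤ Real.exp (K * T) * δ * |t| := by
  rcases le_total 0 t with ht | ht
  · rw [abs_of_nonneg ht] at htT ⊢
    exact norm_le_of_norm_deriv_le_forward hK hδ hw h0
      (fun s hs hs' => h s (by rwa [abs_of_nonneg hs])) ht htT
  · rw [abs_of_nonpos ht] at htT ⊢
    have := norm_le_of_norm_deriv_le_forward (T := T) (w := fun s => w (-s))
      (w' := fun s => -w' (-s)) hK hδ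
      (fun s => ((hw (-s)).scomp s (hasDerivAt_neg s)).congr_deriv (by simp)) (by simpa using h0)
      (fun s hs hs' => by simpa using h (-s) (by rwa [abs_neg, abs_of_nonneg hs]))
      (t := -t) (by linarith) htT
    simpa using this

lemma smooth_slice {W : ℝ → E → G} (hW : ContDiff ℝ (⊤ : ℕ∞) (Function.uncurry W)) (t : ℝ) :
    ContDiff ℝ (⊤ : ℕ∞) (W t) :=
  hW.comp (contDiff_const.prodMk contDiff_id)

lemma smooth_fderiv_slice {W : ℝ → E → G} (hW : ContDiff ℝ (⊤ : ℕ∞) (Function.uncurry W)) :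
    ContDiff ℝ (⊤ : ℕ∞) (Function.uncurry fun t z => fderiv ℝ (W t) z) := by
  have h : ContDiff ℝ (⊤ : ℕ∞)
      (Function.uncurry fun (q : ℝ × E) (y : E) => W q.1 y) :=
    hW.comp ((contDiff_fst.comp contDiff_fst).prodMk contDiff_snd)
  exact h.fderiv (g := fun q : ℝ × E => q.2) contDiff_snd smooth_le_smooth_add_one

/-- The time derivative commutes with the space derivative. -/
lemma hasDerivAt_fderiv_slice {W R : ℝ → E → G}
    (hW : ContDiff ℝ (⊤ : ℕ∞) (Function.uncurry W))
    (hR : ∀ t z, HasDerivAt (fun s => W s z) (R t z) t) (t : ℝ) (z : E) :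
    HasDerivAt (fun s => fderiv ℝ (W s) z) (fderiv ℝ (R t) z) t := by
  set w := Function.uncurry W with hw
  have hwd : ∀ q, HasFDerivAt w (fderiv ℝ w q) q := fun q =>
    (hW.differentiable (by simp) q).hasFDerivAt
  have hwd2 : ∀ q, HasFDerivAt (fderiv ℝ w) (fderiv ℝ (fderiv ℝ w) q) q := fun q =>
    ((smooth_fderiv hW).differentiable (by simp) q).hasFDerivAt
  have hspace : ∀ s y, fderiv ℝ (W s) y
      = (fderiv ℝ w (s, y)).comp (ContinuousLinearMap.inr ℝ ℝ E) := fun s y =>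
    ((hwd (s, y)).comp y (hasFDerivAt_prodMk_right s y)).fderiv
  have htime : ∀ s y, R s y = fderiv ℝ w (s, y) (1, 0) := fun s y => by
    have h := ((hwd (s, y)).comp s (hasFDerivAt_prodMk_left s y)).hasDerivAt
    exact ((hR s y).unique h).trans (by simp)
  have hRfun : R t = fun y => fderiv ℝ w (t, y) (1, 0) := funext fun y => htime t y
  have h1 : HasFDerivAt (fun y => fderiv ℝ w (t, y))
      ((fderiv ℝ (fderiv ℝ w) (t, z)).comp (ContinuousLinearMap.inr ℝ ℝ E)) z :=
    (hwd2 (t, z)).comp z (hasFDerivAt_prodMk_right t z)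
  have h2 : HasDerivAt (fun s => fderiv ℝ w (s, z)) (fderiv ℝ (fderiv ℝ w) (t, z) (1, 0)) t := by
    exact ((hwd2 (t, z)).comp t (hasFDerivAt_prodMk_left t z)).hasDerivAt.congr_deriv (by simp)
  have h3 : HasDerivAt (fun s => fderiv ℝ (W s) z)
      ((fderiv ℝ (fderiv ℝ w) (t, z) (1, 0)).comp (ContinuousLinearMap.inr ℝ ℝ E)) t := by
    simp only [hspace]
    exact ((ContinuousLinearMap.compL ℝ E (ℝ × E) G).flip
      (ContinuousLinearMap.inr ℝ ℝ E)).hasFDerivAt.comp_hasDerivAt t h2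
  refine h3.congr_deriv ?_
  ext v
  have h4 := (h1.clm_apply (hasFDerivAt_const ((1 : ℝ), (0 : E)) z)).fderiv
  rw [hRfun, h4]
  have hsymm : IsSymmSndFDerivAt ℝ w (t, z) :=
    hW.contDiffAt.isSymmSndFDerivAt (by simpa using natCast_le_smooth 2)
  simpa using hsymm.eq (1, 0) (0, v)

/-- Space derivatives of solutions of linear equations with a small source and zero
initial data. -/
theorem exists_jetBound_linear {K T : ℝ} (hK : 0 < K) (hT : 0 < T) (k : ℕ) :
    ∃ C : ℝ, 0 ≤ C ∧ ∀ (G : Type) [NormedAddCommGroup G] [NormedSpace ℝ G]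
      (W g : ℝ → E → G) (M : ℝ → E → G →L[ℝ] G) (δ : ℝ) (z : E),
      ContDiff ℝ (⊤ : ℕ∞) (Function.uncurry W) →
      (∀ t, ContDiff ℝ (⊤ : ℕ∞) (M t)) → (∀ t, ContDiff ℝ (⊤ : ℕ∞) (g t)) →
      (∀ t y, HasDerivAt (fun s => W s y) (M t y (W t y) + g t y) t) →
      (∀ y, W 0 y = 0) →
      (∀ t, |t| ≤ T → JetBound k (M t) z K) → (∀ t, |t| ≤ T → JetBound k (g t) z δ) →
      ∀ t, |t| ≤ T → JetBound k (W t) z (C * δ * |t|) := by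
  induction k with
  | zero =>
    refine ⟨Real.exp (K * T), (Real.exp_pos _).le, ?_⟩
    intro G _ _ W g M δ z hW hM hg hode h0 hMb hgb t ht
    have hδ : 0 ≤ δ := (hgb t ht).nonneg
    refine JetBound.of_norm_le (norm_le_of_norm_deriv_le hK hδ (fun s => hode s z) (h0 z)
      (fun s hs => (norm_add_le _ _).trans (add_le_add ?_ (hgb s hs).norm_le)) ht)
    exact (M s z).le_of_opNorm_le (hMb s hs).norm_le _
  | succ k ih =>
    obtain ⟨C, hC, ih⟩ := ih
    set C' : ℝ := 2 ^ k * K * (C * T) + 1 with hC'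
    have hC'0 : 0 ≤ C' := by positivity
    refine ⟨C + C * C', by positivity, ?_⟩
    intro G _ _ W g M δ z hW hM hg hode h0 hMb hgb t ht
    have hδ : 0 ≤ δ := (hgb t ht).nonneg
    have hWk := ih G W g M δ z hW hM hg hode h0 (fun s hs => (hMb s hs).mono_order k.le_succ)
      (fun s hs => (hgb s hs).mono_order k.le_succ)
    set B : (E →L[ℝ] G →L[ℝ] G) →L[ℝ] G →L[ℝ] (E →L[ℝ] G) :=
      (ContinuousLinearMap.flipₗᵢ ℝ E G G).toContinuousLinearEquiv.toContinuousLinearMap with hB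
    have hB1 : ‖B‖ ≤ 1 := by
      refine ContinuousLinearMap.opNorm_le_bound _ zero_le_one fun f => ?_
      simp [hB]
    have hDW := ih (E →L[ℝ] G) (fun s y => fderiv ℝ (W s) y)
      (fun s y => B (fderiv ℝ (M s) y) (W s y) + fderiv ℝ (g s) y)
      (fun s y => ContinuousLinearMap.compL ℝ E G G (M s y)) (C' * δ) z
      (smooth_fderiv_slice hW) (fun s => (ContinuousLinearMap.contDiff _).comp (hM s))
      (fun s => by
        have h1 := (smooth_fderiv (hM s))
        have h2 := (smooth_fderiv (hg s))
        have h3 := smooth_slice hW s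
        exact ((B.contDiff.comp h1).clm_apply h3).add h2)
      (fun s y => by
        refine (hasDerivAt_fderiv_slice hW hode s y).congr_deriv ?_
        have hMd := ((hM s).differentiable (by simp) y).hasFDerivAt
        have hWd := ((smooth_slice hW s).differentiable (by simp) y).hasFDerivAt
        have hgd := ((hg s).differentiable (by simp) y).hasFDerivAt
        refine ((hMd.clm_apply hWd).add hgd).fderiv.trans ?_
        simp [hB, add_assoc])
      (fun y => by
        have : W 0 = fun _ => 0 := funext h0
        simp [this])
      (fun s hs => by
        refine (((hMb s hs).mono_order k.le_succ).clm_comp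
          (ContinuousLinearMap.compL ℝ E G G) (hM s)).mono ?_
        exact mul_le_of_le_one_left hK.le (ContinuousLinearMap.norm_compL_le _ _ _ _))
      (fun s hs => by
        have h1 := JetBound.bilinear B hB1 (smooth_fderiv (hM s)) (smooth_slice hW s)
          (hMb s hs).fderiv (hWk s hs)
        refine (h1.add ?_ (smooth_fderiv (hg s)) (hgb s hs).fderiv).mono ?_
        · exact (B.contDiff.comp (smooth_fderiv (hM s))).clm_apply (smooth_slice hW s)
        · have : 2 ^ k * K * (C * δ * |s|) ≤ 2 ^ k * K * (C * δ * T) := by gcongr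
          rw [hC']
          linarith)
    refine JetBound.of_fderiv ((hWk t ht).norm_le.trans ?_) ((hDW t ht).mono ?_)
    · have : 0 ≤ C * C' * δ * |t| := by positivity
      linarith
    · have : 0 ≤ C * δ * |t| := by positivity
      linarith

/-- Space derivatives of the difference `Z` between the flow of `F₀ + ε F₁` and the free
flow `L`. -/
theorem exists_jetBound_perturbation (F₀ : E →L[ℝ] E) (L : ℝ → E →L[ℝ] E) {T ε₀ Λ : ℝ}
    (hT : 0 < T) (hε₀ : 0 < ε₀) (hΛ : ∀ t, |t| ≤ T → ‖L t‖ ≤ Λ) (K : ℕ → ℝ) (k : ℕ) :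
    ∃ C : ℝ, 0 ≤ C ∧ ∀ (F₁ : E → E) (ε : ℝ) (Z : ℝ → E → E) (z : E),
      0 < ε → ε ≤ ε₀ → ContDiff ℝ (⊤ : ℕ∞) F₁ →
      ContDiff ℝ (⊤ : ℕ∞) (Function.uncurry Z) →
      (∀ t y, HasDerivAt (fun s => Z s y) (F₀ (Z t y) + ε • F₁ (L t y + Z t y)) t) →
      (∀ y, Z 0 y = 0) →
      (∀ t, |t| ≤ T → ∀ i, JetBound i F₁ (L t z + Z t z) (K i)) →
      ∀ t, |t| ≤ T → JetBound k (Z t) z (C * ε * |t|) := by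
  have hΛ0 : 0 ≤ Λ := (norm_nonneg _).trans (hΛ 0 (by simpa using hT.le))
  induction k with
  | zero =>
    obtain ⟨C, hC, h⟩ := exists_jetBound_linear (E := E) (K := ‖F₀‖ + 1) (T := T)
      (by positivity) hT 0
    refine ⟨C * |K 0|, by positivity, ?_⟩
    intro F₁ ε Z z hε hεε hF₁ hZ hode h0 hb t ht
    refine (h E Z (fun t y => ε • F₁ (L t y + Z t y)) (fun _ _ => F₀) (ε * |K 0|) z hZ
      (fun _ => contDiff_const) (fun s => ?_) hode h0
      (fun s _ => JetBound.const _ (by linarith)) (fun s hs => ?_) t ht).mono (by linarith)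
    · exact (hF₁.comp ((L s).contDiff.add (smooth_slice hZ s))).const_smul ε
    · refine JetBound.of_norm_le ?_
      rw [norm_smul, Real.norm_of_nonneg hε.le]
      gcongr
      exact (hb s hs 0).norm_le.trans (le_abs_self _)
  | succ k ih =>
    obtain ⟨C, hC, ih⟩ := ih
    set D : ℝ := Λ + C * ε₀ * T + 1 with hD
    set J : ℝ := k.factorial * |K (k + 1)| * D ^ k with hJ
    have hJ0 : 0 ≤ J := by positivity
    obtain ⟨C', hC', hlin⟩ := exists_jetBound_linear (E := E) (K := ‖F₀‖ + ε₀ * J + 1) (T := T)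
      (by positivity) hT k
    refine ⟨C + C' * (J * Λ), by positivity, ?_⟩
    intro F₁ ε Z z hε hεε hF₁ hZ hode h0 hb t ht
    have hZk := ih F₁ ε Z z hε hεε hF₁ hZ hode h0 hb
    have hV : ∀ s, ContDiff ℝ (⊤ : ℕ∞) fun y => L s y + Z s y := fun s =>
      (L s).contDiff.add (smooth_slice hZ s)
    have hDF : ∀ s, ContDiff ℝ (⊤ : ℕ∞) fun y => fderiv ℝ F₁ (L s y + Z s y) := fun s =>
      (smooth_fderiv hF₁).comp (hV s)
    have hDFb : ∀ s, |s| ≤ T → JetBound k (fun y => fderiv ℝ F₁ (L s y + Z s y)) z J :=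
      fun s hs => JetBound.comp_clm_add (smooth_fderiv hF₁) (L s) (smooth_slice hZ s)
        ((hb s hs (k + 1)).fderiv.mono (le_abs_self _)) (hΛ s hs)
        ((hZk s hs).mono (by gcongr))
    set B := ContinuousLinearMap.compL ℝ E E E with hBdef
    have hB1 : ‖B‖ ≤ 1 := ContinuousLinearMap.norm_compL_le _ _ _ _
    have hDZ := hlin (E →L[ℝ] E) (fun s y => fderiv ℝ (Z s) y)
      (fun s y => ε • B.flip (L s) (fderiv ℝ F₁ (L s y + Z s y)))
      (fun s y => B (F₀ + ε • fderiv ℝ F₁ (L s y + Z s y))) (ε * (J * Λ)) z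
      (smooth_fderiv_slice hZ)
      (fun s => B.contDiff.comp (contDiff_const.add ((hDF s).const_smul ε)))
      (fun s => (((B.flip (L s)).contDiff).comp (hDF s)).const_smul ε)
      (fun s y => by
        refine (hasDerivAt_fderiv_slice hZ hode s y).congr_deriv ?_
        have hZd := ((smooth_slice hZ s).differentiable (by simp) y).hasFDerivAt
        have hFd := (hF₁.differentiable (by simp) (L s y + Z s y)).hasFDerivAt
        have hVd := (L s).hasFDerivAt.add hZd
        have hcomp : HasFDerivAt (fun y => F₁ (L s y + Z s y))
            ((fderiv ℝ F₁ (L s y + Z s y)).comp (L s + fderiv ℝ (Z s) y)) y :=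
          HasFDerivAt.comp (f := fun y => L s y + Z s y) y hFd hVd
        refine ((F₀.hasFDerivAt.comp y hZd).add (hcomp.const_smul ε)).fderiv.trans ?_
        ext v
        simp [hBdef]
        abel)
      (fun y => by
        have : Z 0 = fun _ => 0 := funext h0
        simp [this])
      (fun s hs => by
        have h1 := (JetBound.const (k := k) (z := z) F₀ le_rfl).add contDiff_const
          ((hDF s).const_smul ε) ((hDFb s hs).const_smul ε (hDF s))
        refine (h1.clm_comp B (contDiff_const.add ((hDF s).const_smul ε))).mono ?_
        rw [abs_of_pos hε]
        refine (mul_le_of_le_one_left (by positivity) hB1).trans ?_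
        have : ε * J ≤ ε₀ * J := by gcongr
        linarith)
      (fun s hs => by
        have h1 := (hDFb s hs).clm_comp (B.flip (L s)) (hDF s)
        refine (h1.const_smul ε ((B.flip (L s)).contDiff.comp (hDF s))).mono ?_
        rw [abs_of_pos hε]
        have h2 : ‖B.flip (L s)‖ ≤ Λ := by
          refine (ContinuousLinearMap.le_opNorm _ _).trans ?_
          rw [ContinuousLinearMap.opNorm_flip]
          exact (mul_le_of_le_one_left (norm_nonneg _) hB1).trans (hΛ s hs)
        rw [mul_comm J Λ]
        gcongr)
    refine JetBound.of_fderiv ((hZk t ht).norm_le.trans ?_) ((hDZ t ht).mono ?_)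
    · have : 0 ≤ C' * (J * Λ) * ε * |t| := by positivity
      linarith
    · have : 0 ≤ C * ε * |t| := by positivity
      linarith

end JetBounds
section DirectionalDerivatives

variable {E : Type} [NormedAddCommGroup E] [NormedSpace ℝ E]

/-- The iterated directional derivative along a list of vectors. -/
def dirDeriv (l : List E) (f : E → ℝ) : E → ℝ :=
  l.foldr (fun v g z => fderiv ℝ g z v) f

lemma dirDeriv_cons (v : E) (l : List E) (f : E → ℝ) :
    dirDeriv (v :: l) f = fun z => fderiv ℝ (dirDeriv l f) z v := rfl

lemma dirDeriv_append (l l' : List E) (f : E → ℝ) :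
    dirDeriv (l ++ l') f = dirDeriv l (dirDeriv l' f) := by
  simp [dirDeriv]

lemma smooth_fderiv_apply {f : E → ℝ} (hf : ContDiff ℝ (⊤ : ℕ∞) f) (v : E) :
    ContDiff ℝ (⊤ : ℕ∞) fun z => fderiv ℝ f z v :=
  (smooth_fderiv hf).clm_apply contDiff_const

lemma smooth_dirDeriv {f : E → ℝ} (hf : ContDiff ℝ (⊤ : ℕ∞) f) (l : List E) :
    ContDiff ℝ (⊤ : ℕ∞) (dirDeriv l f) := by
  induction l with
  | nil => exact hf
  | cons v l ih => exact smooth_fderiv_apply ih v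

lemma JetBound.dirDeriv {f : E → ℝ} (hf : ContDiff ℝ (⊤ : ℕ∞) f) {z : E} {K : ℝ} (l : List E)
    (hl : ∀ v ∈ l, ‖v‖ ≤ 1) {k : ℕ} (h : JetBound (k + l.length) f z K) :
    JetBound k (dirDeriv l f) z K := by
  induction l generalizing k with
  | nil => exact h
  | cons v l ih =>
    have h1 : JetBound (k + 1) (Paper.dirDeriv l f) z K :=
      ih (fun w hw => hl w (List.mem_cons_of_mem _ hw))
        (h.mono_order (by simp only [List.length_cons]; omega))
    refine (h1.fderiv.clm_comp (ContinuousLinearMap.apply ℝ ℝ v)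
      (smooth_fderiv (smooth_dirDeriv hf l))).mono (mul_le_of_le_one_left h.nonneg ?_)
    refine ContinuousLinearMap.opNorm_le_bound _ zero_le_one fun φ => ?_
    rw [ContinuousLinearMap.apply_apply, one_mul]
    exact φ.le_of_opNorm_le_of_le le_rfl (hl v List.mem_cons_self) |>.trans (by simp)

lemma hasDerivAt_dirDeriv {W R : ℝ → E → ℝ} (hW : ContDiff ℝ (⊤ : ℕ∞) (Function.uncurry W))
    (hR : ∀ t z, HasDerivAt (fun s => W s z) (R t z) t) (l : List E) :
    ContDiff ℝ (⊤ : ℕ∞) (Function.uncurry fun t z => dirDeriv l (W t) z) ∧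
      ∀ t z, HasDerivAt (fun s => dirDeriv l (W s) z) (dirDeriv l (R t) z) t := by
  induction l with
  | nil => exact ⟨hW, hR⟩
  | cons v l ih =>
    refine ⟨(smooth_fderiv_slice ih.1).clm_apply contDiff_const, fun t z => ?_⟩
    exact (ContinuousLinearMap.apply ℝ ℝ v).hasFDerivAt.comp_hasDerivAt t
      (hasDerivAt_fderiv_slice ih.1 ih.2 t z)

end DirectionalDerivatives

section MultiIndices

variable {n : ℕ}

lemma smooth_pd {f : Eu n → ℝ} (hf : ContDiff ℝ (⊤ : ℕ∞) f) (i : Fin n) :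
    ContDiff ℝ (⊤ : ℕ∞) (pd i f) :=
  smooth_fderiv_apply hf _

lemma smooth_foldr_pd {f : Eu n → ℝ} (hf : ContDiff ℝ (⊤ : ℕ∞) f) (l : List (Fin n)) :
    ContDiff ℝ (⊤ : ℕ∞) (l.foldr pd f) := by
  induction l with
  | nil => exact hf
  | cons i l ih => exact smooth_pd ih i

lemma pd_comm {f : Eu n → ℝ} (hf : ContDiff ℝ (⊤ : ℕ∞) f) (i j : Fin n) :
    pd i (pd j f) = pd j (pd i f) := by
  have key : ∀ (i j : Fin n) (x : Eu n), pd i (pd j f) x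
      = fderiv ℝ (fderiv ℝ f) x (EuclideanSpace.single i 1) (EuclideanSpace.single j 1) := by
    intro i j x
    have h := ((smooth_fderiv hf).differentiable (by simp) x).hasFDerivAt
    have h' := (h.clm_apply (hasFDerivAt_const (EuclideanSpace.single j (1 : ℝ)) x)).fderiv
    change fderiv ℝ (fun y => fderiv ℝ f y (EuclideanSpace.single j 1)) x _ = _
    rw [h']
    simp
  ext x
  have hsymm : IsSymmSndFDerivAt ℝ f x :=
    hf.contDiffAt.isSymmSndFDerivAt (by simpa using natCast_le_smooth 2)
  rw [key, key, hsymm.eq]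

lemma foldr_pd_perm {f : Eu n → ℝ} (hf : ContDiff ℝ (⊤ : ℕ∞) f) {l l' : List (Fin n)}
    (h : l.Perm l') : l.foldr pd f = l'.foldr pd f := by
  induction h with
  | nil => rfl
  | cons i _ ih => simp only [List.foldr_cons, ih]
  | swap i j l => exact pd_comm (smooth_foldr_pd hf l) j i
  | trans _ _ ih ih' => exact ih.trans ih'

lemma count_mIdx (γ : Fin n → ℕ) (i : Fin n) : (mIdx γ).count i = γ i := by
  have key : ∀ l : List (Fin n), l.Nodup →
      (l.foldr (fun i acc => List.replicate (γ i) i ++ acc) []).count i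
        = if i ∈ l then γ i else 0 := by
    intro l hl
    induction l with
    | nil => simp
    | cons a l ih =>
      rw [List.nodup_cons] at hl
      rw [List.foldr_cons, List.count_append, ih hl.2, List.count_replicate]
      by_cases h : i = a
      · subst h; simp [hl.1]
      · have h' : ¬ a = i := fun e => h e.symm
        simp [h, h']
  exact (key _ (List.nodup_finRange n)).trans (by simp)

lemma foldr_pd_eq_mderiv {f : Eu n → ℝ} (hf : ContDiff ℝ (⊤ : ℕ∞) f) (l : List (Fin n)) :
    l.foldr pd f = mderiv (fun i => l.count i) f :=
  foldr_pd_perm hf (List.perm_iff_count.2 fun i => (count_mIdx (fun i => l.count i) i).symm)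

lemma sum_count_eq_length (l : List (Fin n)) : ∑ i, l.count i = l.length := by
  induction l with
  | nil => simp
  | cons a l ih => simp [List.count_cons, Finset.sum_add_distrib, ih]

lemma norm_proj_le (i : Fin n) : ‖(EuclideanSpace.proj i : Eu n →L[ℝ] ℝ)‖ ≤ 1 :=
  ContinuousLinearMap.opNorm_le_bound _ zero_le_one fun x => by
    simpa using PiLp.norm_apply_le x i

lemma fderiv_eq_sum_pd (f : Eu n → ℝ) (x : Eu n) :
    fderiv ℝ f x = ∑ i, ContinuousLinearMap.toSpanSingleton ℝ
      (EuclideanSpace.proj i : Eu n →L[ℝ] ℝ) (pd i f x) := by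
  ext v
  conv_lhs => rw [← (EuclideanSpace.basisFun (Fin n) ℝ).sum_repr v]
  simp [pd, mul_comm]

lemma norm_iteratedFDeriv_le_of_foldr_pd {f : Eu n → ℝ} (hf : ContDiff ℝ (⊤ : ℕ∞) f)
    {x : Eu n} {K : ℝ} (ℓ : ℕ) (h : ∀ l : List (Fin n), l.length = ℓ → |l.foldr pd f x| ≤ K) :
    ‖iteratedFDeriv ℝ ℓ f x‖ ≤ n ^ ℓ * K := by
  induction ℓ generalizing f with
  | zero => simpa using h [] rfl
  | succ ℓ ih =>
    rw [← norm_iteratedFDeriv_fderiv, funext (fderiv_eq_sum_pd f)]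
    have hs : ∀ i : Fin n, ContDiff ℝ (⊤ : ℕ∞) fun y => ContinuousLinearMap.toSpanSingleton ℝ
        (EuclideanSpace.proj i : Eu n →L[ℝ] ℝ) (pd i f y) := fun i =>
      (ContinuousLinearMap.contDiff _).comp (smooth_pd hf i)
    rw [iteratedFDeriv_sum fun i _ => (hs i).of_le (natCast_le_smooth ℓ), Finset.sum_apply]
    calc _ ≤ ∑ _i : Fin n, n ^ ℓ * K := by
          refine (norm_sum_le _ _).trans (Finset.sum_le_sum fun i _ => ?_)
          have h1 : ‖iteratedFDeriv ℝ ℓ (pd i f) x‖ ≤ n ^ ℓ * K :=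
            ih (smooth_pd hf i) fun l hl => by simpa using h (l ++ [i]) (by simp [hl])
          refine ((ContinuousLinearMap.toSpanSingleton ℝ
            (EuclideanSpace.proj i : Eu n →L[ℝ] ℝ)).norm_iteratedFDeriv_comp_left
              (smooth_pd hf i).contDiffAt (natCast_le_smooth ℓ)).trans ?_
          rw [ContinuousLinearMap.norm_toSpanSingleton]
          exact (mul_le_of_le_one_left (norm_nonneg _) (norm_proj_le i)).trans h1
      _ = n ^ (ℓ + 1) * K := by
          simp only [Finset.sum_const, Finset.card_univ, Fintype.card_fin, nsmul_eq_mul]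
          ring

lemma foldr_pdX_eq {g : Eu n × Eu n → ℝ} (hg : ContDiff ℝ (⊤ : ℕ∞) g) (l : List (Fin n)) :
    l.foldr pdX (fun x ξ => g (x, ξ)) = fun x ξ =>
      dirDeriv (l.map fun i => (EuclideanSpace.single i (1 : ℝ), (0 : Eu n))) g (x, ξ) := by
  induction l with
  | nil => rfl
  | cons i l ih =>
    rw [List.foldr_cons, ih, List.map_cons, dirDeriv_cons]
    ext x ξ
    have h := ((smooth_dirDeriv hg (l.map fun i => (EuclideanSpace.single i (1 : ℝ),
      (0 : Eu n)))).differentiable (by simp) (x, ξ)).hasFDerivAt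
    have h' := (HasFDerivAt.comp (f := fun y => (y, ξ)) x h (hasFDerivAt_prodMk_left x ξ)).fderiv
    simp only [Function.comp_def] at h'
    simp [pdX, h']

lemma foldr_pdXi_eq {g : Eu n × Eu n → ℝ} (hg : ContDiff ℝ (⊤ : ℕ∞) g) (l : List (Fin n)) :
    l.foldr pdXi (fun x ξ => g (x, ξ)) = fun x ξ =>
      dirDeriv (l.map fun i => ((0 : Eu n), EuclideanSpace.single i (1 : ℝ))) g (x, ξ) := by
  induction l with
  | nil => rfl
  | cons i l ih =>
    rw [List.foldr_cons, ih, List.map_cons, dirDeriv_cons]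
    ext x ξ
    have h := ((smooth_dirDeriv hg (l.map fun i => ((0 : Eu n),
      EuclideanSpace.single i (1 : ℝ)))).differentiable (by simp) (x, ξ)).hasFDerivAt
    have h' := (HasFDerivAt.comp (f := fun η => (x, η)) ξ h (hasFDerivAt_prodMk_right x ξ)).fderiv
    simp only [Function.comp_def] at h'
    simp [pdXi, h']

/-- The directions in phase space attached to a pair of multi-indices. -/
def phaseDirs (A B : Fin n → ℕ) : List (Eu n × Eu n) :=
  (mIdx A).map (fun i => (EuclideanSpace.single i (1 : ℝ), (0 : Eu n))) ++
    (mIdx B).map fun i => ((0 : Eu n), EuclideanSpace.single i (1 : ℝ))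

lemma norm_le_one_of_mem_phaseDirs {A B : Fin n → ℕ} {v : Eu n × Eu n}
    (hv : v ∈ phaseDirs A B) : ‖v‖ ≤ 1 := by
  simp only [phaseDirs, List.mem_append, List.mem_map] at hv
  rcases hv with ⟨i, _, rfl⟩ | ⟨i, _, rfl⟩ <;> simp [Prod.norm_def]

lemma mderiv2_eq_dirDeriv {g : Eu n × Eu n → ℝ} (hg : ContDiff ℝ (⊤ : ℕ∞) g)
    (A B : Fin n → ℕ) :
    mderiv2 A B (fun x ξ => g (x, ξ)) = fun x ξ => dirDeriv (phaseDirs A B) g (x, ξ) := by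
  rw [mderiv2, foldr_pdXi_eq hg, foldr_pdX_eq (smooth_dirDeriv hg _), phaseDirs,
    dirDeriv_append]

end MultiIndices
section Hamiltonian

variable {n : ℕ}

/-- The symplectic gradient attached to a covector `φ`: the vector `(∂_ξ φ, -∂_x φ)`. -/
def symplGrad (n : ℕ) : ((Eu n × Eu n) →L[ℝ] ℝ) →L[ℝ] (Eu n × Eu n) :=
  ∑ j, ((ContinuousLinearMap.apply ℝ ℝ ((0 : Eu n), EuclideanSpace.single j (1 : ℝ))).smulRight
      (EuclideanSpace.single j (1 : ℝ), (0 : Eu n)) -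
    (ContinuousLinearMap.apply ℝ ℝ (EuclideanSpace.single j (1 : ℝ), (0 : Eu n))).smulRight
      ((0 : Eu n), EuclideanSpace.single j (1 : ℝ)))

lemma symplGrad_apply (φ : (Eu n × Eu n) →L[ℝ] ℝ) :
    symplGrad n φ = ∑ j, (φ (0, EuclideanSpace.single j 1) • (EuclideanSpace.single j 1, 0) -
      φ (EuclideanSpace.single j 1, 0) • (0, EuclideanSpace.single j 1)) := by
  simp only [symplGrad, sum_apply]
  rfl

lemma symplGrad_fst (φ : (Eu n × Eu n) →L[ℝ] ℝ) (i : Fin n) :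
    (symplGrad n φ).1 i = φ (0, EuclideanSpace.single i 1) := by
  simp [symplGrad_apply, Prod.fst_sum, Finset.sum_apply, Pi.single_apply]

lemma symplGrad_snd (φ : (Eu n × Eu n) →L[ℝ] ℝ) (i : Fin n) :
    (symplGrad n φ).2 i = -φ (EuclideanSpace.single i 1, 0) := by
  simp [symplGrad_apply, Prod.snd_sum, Finset.sum_apply, Pi.single_apply]

lemma apply_symplGrad_self (φ : (Eu n × Eu n) →L[ℝ] ℝ) : φ (symplGrad n φ) = 0 := by
  rw [symplGrad_apply, map_sum]
  exact Finset.sum_eq_zero fun j _ => by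
    rw [map_sub, map_smul, map_smul, smul_eq_mul, smul_eq_mul, mul_comm, sub_self]

/-- The Hamiltonian vector field `(x, ξ) ↦ (2ξ, 0)` of `|ξ|²`. -/
def freeField (n : ℕ) : (Eu n × Eu n) →L[ℝ] (Eu n × Eu n) :=
  ((2 : ℝ) • ContinuousLinearMap.snd ℝ (Eu n) (Eu n)).prod 0

/-- The flow `(x, ξ) ↦ (x + 2tξ, ξ)` of `|ξ|²`. -/
def freeFlow (n : ℕ) (t : ℝ) : (Eu n × Eu n) →L[ℝ] (Eu n × Eu n) :=
  (ContinuousLinearMap.fst ℝ (Eu n) (Eu n) +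
    (2 * t) • ContinuousLinearMap.snd ℝ (Eu n) (Eu n)).prod (ContinuousLinearMap.snd ℝ _ _)

lemma norm_freeFlow_le {T t : ℝ} (ht : |t| ≤ T) : ‖freeFlow n t‖ ≤ 1 + 2 * T := by
  have hT : 0 ≤ T := (abs_nonneg t).trans ht
  refine ContinuousLinearMap.opNorm_le_bound _ (by positivity) fun z => ?_
  have h1 : ‖z.1‖ ≤ ‖z‖ := norm_fst_le z
  have h2 : ‖z.2‖ ≤ ‖z‖ := norm_snd_le z
  refine max_le ?_ ?_
  · refine (norm_add_le z.1 ((2 * t) • z.2)).trans ?_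
    rw [norm_smul, Real.norm_eq_abs, abs_mul, abs_two]
    have : 2 * |t| * ‖z.2‖ ≤ 2 * T * ‖z‖ := by gcongr
    linarith
  · change ‖z.2‖ ≤ _
    have : 0 ≤ 2 * T * ‖z‖ := by positivity
    linarith

lemma freeField_freeFlow (t : ℝ) (z : Eu n × Eu n) :
    freeField n (freeFlow n t z) = freeField n z := by
  simp [freeField, freeFlow]

lemma hasDerivAt_freeFlow (t : ℝ) (z : Eu n × Eu n) :
    HasDerivAt (fun s => freeFlow n s z) (freeField n z) t := by
  have h1 : HasDerivAt (fun s : ℝ => z.1 + (2 * s) • z.2) ((2 : ℝ) • z.2) t := by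
    have := (((hasDerivAt_id t).const_mul 2).smul_const z.2).const_add z.1
    simpa using this
  exact h1.prodMk (hasDerivAt_const t z.2)

lemma smooth_freeFlow :
    ContDiff ℝ (⊤ : ℕ∞) (Function.uncurry fun (t : ℝ) (z : Eu n × Eu n) => freeFlow n t z) := by
  have : ContDiff ℝ (⊤ : ℕ∞) fun q : ℝ × Eu n × Eu n =>
      (q.2.1 + (2 * q.1) • q.2.2, q.2.2) := by fun_prop
  exact this

/-- The quadratic perturbation `q(x, ξ) = ∑ b_{jk}(x) ξ_j ξ_k`. -/
def quadPert (b : Fin n → Fin n → Eu n → ℝ) (z : Eu n × Eu n) : ℝ :=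
  ∑ j, ∑ k, b j k z.1 * z.2 j * z.2 k

lemma smooth_quadPert {b : Fin n → Fin n → Eu n → ℝ}
    (hb : ∀ j k, ContDiff ℝ (⊤ : ℕ∞) (b j k)) : ContDiff ℝ (⊤ : ℕ∞) (quadPert b) := by
  unfold quadPert
  fun_prop

lemma abs_quadPert_le {b : Fin n → Fin n → Eu n → ℝ} {a : ℝ} {z : Eu n × Eu n}
    (h : ∑ j, ∑ k, |b j k z.1| ≤ a) : |quadPert b z| ≤ a * ‖z.2‖ ^ 2 := by
  calc |quadPert b z| ≤ ∑ j, ∑ k, |b j k z.1| * ‖z.2‖ ^ 2 := by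
        refine (Finset.abs_sum_le_sum_abs _ _).trans (Finset.sum_le_sum fun j _ => ?_)
        refine (Finset.abs_sum_le_sum_abs _ _).trans (Finset.sum_le_sum fun k _ => ?_)
        rw [abs_mul, abs_mul, pow_two, mul_assoc]
        gcongr
        · exact PiLp.norm_apply_le z.2 j
        · exact PiLp.norm_apply_le z.2 k
    _ = (∑ j, ∑ k, |b j k z.1|) * ‖z.2‖ ^ 2 := by simp only [Finset.sum_mul]
    _ ≤ a * ‖z.2‖ ^ 2 := by gcongr

/-- Bounds on a perturbation whose coefficients have bounded derivatives, uniform on bounded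
sets of momenta. -/
lemma exists_jetBound_quadPert (n : ℕ) (A : ℕ → ℝ) (k : ℕ) :
    ∃ K : ℝ, ∀ b : Fin n → Fin n → Eu n → ℝ, (∀ j l, ContDiff ℝ (⊤ : ℕ∞) (b j l)) →
      (∀ (l : List (Fin n)) (j i : Fin n) (x : Eu n),
        |l.foldr pd (b j i) x| ≤ A l.length) →
      ∀ z : Eu n × Eu n, ‖z.2‖ ≤ 4 → JetBound k (quadPert b) z K := by
  set N : ℝ := ∑ ℓ ∈ Finset.range (k + 1), |n ^ ℓ * A ℓ| with hN
  refine ⟨∑ _j : Fin n, ∑ _l : Fin n,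
    2 ^ k * (2 ^ k * (k.factorial * N * 1 ^ k) * 4) * 4, ?_⟩
  intro b hb hbd z hz
  have hfst : ∀ i, 1 ≤ i → i ≤ k →
      ‖iteratedFDeriv ℝ i (Prod.fst : Eu n × Eu n → Eu n) z‖ ≤ 1 := by
    intro i hi _
    obtain ⟨i, rfl⟩ : ∃ m, i = m + 1 := ⟨i - 1, by omega⟩
    rw [← norm_iteratedFDeriv_fderiv]
    have e : fderiv ℝ (Prod.fst : Eu n × Eu n → Eu n)
        = fun _ => ContinuousLinearMap.fst ℝ (Eu n) (Eu n) := funext fun y => fderiv_fst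
    rw [e]
    exact JetBound.const _ (ContinuousLinearMap.norm_fst_le _ _ _) i le_rfl
  have hbz : ∀ j l, JetBound k (fun y : Eu n × Eu n => b j l y.1) z
      (k.factorial * N * 1 ^ k) := by
    intro j l
    refine JetBound.comp (hb j l) contDiff_fst (fun i hi => ?_) le_rfl hfst
    refine (norm_iteratedFDeriv_le_of_foldr_pd (hb j l) (K := A i) i ?_).trans ?_
    · rintro s rfl
      exact hbd s j l _
    · exact (le_abs_self _).trans (Finset.single_le_sum (f := fun ℓ => |(n : ℝ) ^ ℓ * A ℓ|)
        (fun _ _ => abs_nonneg _) (Finset.mem_range.2 (Nat.lt_succ_of_le hi)))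
  have hcoord : ∀ j, JetBound k (fun y : Eu n × Eu n => y.2 j) z 4 := by
    intro j
    refine JetBound.clm ((EuclideanSpace.proj j : Eu n →L[ℝ] ℝ).comp
      (ContinuousLinearMap.snd ℝ (Eu n) (Eu n))) ?_ ?_
    · refine (ContinuousLinearMap.opNorm_comp_le _ _).trans ?_
      have h1 := norm_proj_le j
      have h2 := ContinuousLinearMap.norm_snd_le ℝ (Eu n) (Eu n)
      have := mul_le_one₀ h1 (norm_nonneg _) h2
      linarith
    · exact (PiLp.norm_apply_le z.2 j).trans hz
  have hmul : ‖ContinuousLinearMap.mul ℝ ℝ‖ ≤ 1 := ContinuousLinearMap.opNorm_mul_le ℝ ℝ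
  have hsb : ∀ j l, ContDiff ℝ (⊤ : ℕ∞) fun y : Eu n × Eu n => b j l y.1 := fun j l =>
    (hb j l).comp contDiff_fst
  have hsc : ∀ j, ContDiff ℝ (⊤ : ℕ∞) fun y : Eu n × Eu n => y.2 j := by
    intro j
    fun_prop
  have hterm : ∀ j l, JetBound k (fun y : Eu n × Eu n => b j l y.1 * y.2 j * y.2 l) z
      (2 ^ k * (2 ^ k * (k.factorial * N * 1 ^ k) * 4) * 4) := fun j l =>
    JetBound.bilinear (ContinuousLinearMap.mul ℝ ℝ) hmul ((hsb j l).mul (hsc j)) (hsc l)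
      (JetBound.bilinear (ContinuousLinearMap.mul ℝ ℝ) hmul (hsb j l) (hsc j) (hbz j l)
        (hcoord j)) (hcoord l)
  exact JetBound.sum (fun j _ => ContDiff.sum fun l _ => ((hsb j l).mul (hsc j)).mul (hsc l))
    fun j _ => JetBound.sum (fun l _ => ((hsb j l).mul (hsc j)).mul (hsc l))
      fun l _ => hterm j l

/-- The weighted bounds on the coefficients control all iterated partial derivatives. -/
lemma abs_foldr_pd_le_of_weighted {σ₀ : ℝ} (hσ₀ : 0 < σ₀) {A : ℕ → ℝ} (hA : ∀ ℓ, 0 < A ℓ)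
    {b : Fin n → Fin n → Eu n → ℝ} (hb : ∀ j k, ContDiff ℝ (⊤ : ℕ∞) (b j k))
    (hbd : ∀ (ℓ : ℕ) (x : Eu n),
      (∑ γ ∈ Finset.Nat.antidiagonalTuple n ℓ, ∑ j, ∑ k, |mderiv γ (b j k) x|) ≤
        A ℓ * jb x ^ (-(1 + (ℓ : ℝ) + σ₀)))
    (l : List (Fin n)) (x : Eu n) :
    ∑ j, ∑ k, |l.foldr pd (b j k) x| ≤ A l.length := by
  have hjb : jb x ^ (-(1 + (l.length : ℝ) + σ₀)) ≤ 1 := by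
    refine Real.rpow_le_one_of_one_le_of_nonpos ?_ ?_
    · rw [jb, Real.one_le_sqrt]
      nlinarith [sq_nonneg ‖x‖]
    · have : (0 : ℝ) ≤ l.length := Nat.cast_nonneg _
      linarith
  simp only [foldr_pd_eq_mderiv (hb _ _) l]
  calc _ ≤ ∑ γ ∈ Finset.Nat.antidiagonalTuple n l.length, ∑ j, ∑ k, |mderiv γ (b j k) x| :=
        Finset.single_le_sum (f := fun γ => ∑ j, ∑ k, |mderiv γ (b j k) x|)
          (fun γ _ => Finset.sum_nonneg fun j _ => Finset.sum_nonneg fun k _ => abs_nonneg _)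
          (Finset.Nat.mem_antidiagonalTuple.2 (sum_count_eq_length l))
    _ ≤ A l.length * jb x ^ (-(1 + (l.length : ℝ) + σ₀)) := hbd _ x
    _ ≤ A l.length := mul_le_of_le_one_right (hA _).le hjb

/-- The Hamiltonian `|ξ|² + ε q(x, ξ)`. -/
def hamiltonian (ε : ℝ) (b : Fin n → Fin n → Eu n → ℝ) (z : Eu n × Eu n) : ℝ :=
  ‖z.2‖ ^ 2 + ε * quadPert b z

lemma differentiable_hamiltonian (ε : ℝ) {b : Fin n → Fin n → Eu n → ℝ}
    (hb : ∀ j k, ContDiff ℝ (⊤ : ℕ∞) (b j k)) : Differentiable ℝ (hamiltonian ε b) := by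
  have h1 : ContDiff ℝ (⊤ : ℕ∞) (hamiltonian ε b) :=
    (contDiff_snd.norm_sq ℝ).add (contDiff_const.mul (smooth_quadPert hb))
  exact h1.differentiable (by simp)

/-- The Hamiltonian vector field of `|ξ|² + ε q`. -/
lemma symplGrad_fderiv_hamiltonian (ε : ℝ) {b : Fin n → Fin n → Eu n → ℝ}
    (hb : ∀ j k, ContDiff ℝ (⊤ : ℕ∞) (b j k)) (z : Eu n × Eu n) :
    symplGrad n (fderiv ℝ (hamiltonian ε b) z)
      = freeField n z + ε • symplGrad n (fderiv ℝ (quadPert b) z) := by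
  have hq := ((smooth_quadPert hb).differentiable (by simp) z).hasFDerivAt
  have h1 := (hasStrictFDerivAt_norm_sq z.2).hasFDerivAt.comp z
    (hasFDerivAt_snd (𝕜 := ℝ) (E := Eu n) (F := Eu n) (p := z))
  have h2 : HasFDerivAt (hamiltonian ε b) _ z := h1.add (hq.const_mul ε)
  rw [h2.fderiv, map_add, map_smul]
  congr 1
  ext i
  · rw [symplGrad_fst]
    simp [freeField, EuclideanSpace.inner_single_right]
  · rw [symplGrad_snd]
    simp [freeField]

/-- Energy conservation along the flow and the resulting bound on the momentum. -/
lemma norm_momentum_le {ε a : ℝ} (hε : 0 < ε) (ha : ε * a ≤ 1 / 10)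
    {b : Fin n → Fin n → Eu n → ℝ} (hb : ∀ j k, ContDiff ℝ (⊤ : ℕ∞) (b j k))
    (hbd : ∀ x, ∑ j, ∑ k, |b j k x| ≤ a) {V : ℝ → Eu n × Eu n}
    (hV : ∀ t, HasDerivAt V (symplGrad n (fderiv ℝ (hamiltonian ε b) (V t))) t)
    (h0 : ‖(V 0).2‖ ≤ 3) (t : ℝ) : ‖(V t).2‖ ≤ 4 := by
  have hd : ∀ s, HasDerivAt (fun s => hamiltonian ε b (V s)) 0 s := fun s => by
    have h := ((differentiable_hamiltonian ε hb (V s)).hasFDerivAt).comp_hasDerivAt s (hV s)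
    rwa [apply_symplGrad_self] at h
  have hconst : hamiltonian ε b (V t) = hamiltonian ε b (V 0) :=
    is_const_of_deriv_eq_zero (fun s => (hd s).differentiableAt) (fun s => (hd s).deriv) t 0
  have hq : ∀ z : Eu n × Eu n, |ε * quadPert b z| ≤ 1 / 10 * ‖z.2‖ ^ 2 := fun z => by
    rw [abs_mul, abs_of_pos hε]
    calc ε * |quadPert b z| ≤ ε * (a * ‖z.2‖ ^ 2) := by
          gcongr; exact abs_quadPert_le (hbd z.1)
      _ = ε * a * ‖z.2‖ ^ 2 := by ring
      _ ≤ _ := by gcongr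
  have h1 := abs_le.1 (hq (V t))
  have h2 := abs_le.1 (hq (V 0))
  unfold hamiltonian at hconst
  have h3 : ‖(V 0).2‖ ^ 2 ≤ 3 ^ 2 := by gcongr
  exact abs_le_of_sq_le_sq' (by linarith) (by norm_num) |>.2

end Hamiltonian
/-- **Proposition III.2.1.** Set `r(t,x,ξ) = x(t,x,ξ) − (x + 2tξ)` and
`ζ(t,x,ξ) = ξ(t,x,ξ) − ξ`. For every `T > 0` and multi-indices `A, B` there is
`C_{A,B} > 0`, depending only on `T, A, B, n, σ₀` and the constants `A_ℓ` (but not on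
`ε`), such that for `Z ∈ {r, ζ}`, all `|t| ≤ T` and all `(x,ξ)` with `|ξ| ≤ 3`:
(i) `|∂_x^A ∂_ξ^B Z(t,x,ξ)| ≤ C_{A,B} ε |t|` and
(ii) `|∂_t ∂_x^A ∂_ξ^B Z(t,x,ξ)| ≤ C_{A,B} ε`. -/
theorem statement4
    (n : ℕ) (hn : 1 ≤ n) (σ₀ : ℝ) (hσ₀ : 0 < σ₀) (hσ₀' : σ₀ < 1)
    (A : ℕ → ℝ) (hApos : ∀ ℓ, 0 < A ℓ)
    (T : ℝ) (hT : 0 < T) (Am Bm : Fin n → ℕ) :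
    ∃ C : ℝ, 0 < C ∧
      ∀ b : Fin n → Fin n → Eu n → ℝ,
        (∀ j k, ContDiff ℝ (⊤ : ℕ∞) (b j k)) →
        (∀ (ℓ : ℕ) (x : Eu n),
          (∑ γ ∈ Finset.Nat.antidiagonalTuple n ℓ, ∑ j, ∑ k, |mderiv γ (b j k) x|) ≤
            A ℓ * jb x ^ (-(1 + (ℓ : ℝ) + σ₀))) →
      ∀ ε : ℝ, 0 < ε → ε * A 0 ≤ 1 / 10 →
      ∀ p : Eu n → Eu n → ℝ,
        (∀ x ξ, p x ξ = ‖ξ‖ ^ 2 + ε * ∑ j, ∑ k, b j k x * ξ j * ξ k) →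
      ∀ Xf Ξf : ℝ → Eu n → Eu n → Eu n,
        ContDiff ℝ (⊤ : ℕ∞)
          (fun q : ℝ × Eu n × Eu n => (Xf q.1 q.2.1 q.2.2, Ξf q.1 q.2.1 q.2.2)) →
        (∀ (t : ℝ) (x ξ : Eu n) (j : Fin n),
          HasDerivAt (fun s => Xf s x ξ j)
            (fderiv ℝ (fun η => p (Xf t x ξ) η) (Ξf t x ξ)
              (EuclideanSpace.single j 1)) t) →
        (∀ (t : ℝ) (x ξ : Eu n) (j : Fin n),
          HasDerivAt (fun s => Ξf s x ξ j)
            (-(fderiv ℝ (fun y => p y (Ξf t x ξ)) (Xf t x ξ)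
              (EuclideanSpace.single j 1))) t) →
        (∀ x ξ, Xf 0 x ξ = x) → (∀ x ξ, Ξf 0 x ξ = ξ) →
      ∀ (t : ℝ) (x ξ : Eu n), |t| ≤ T → ‖ξ‖ ≤ 3 → ∀ j : Fin n,
        (|mderiv2 Am Bm (fun y η => Xf t y η j - (y j + 2 * t * η j)) x ξ| ≤
            C * ε * |t| ∧
          |mderiv2 Am Bm (fun y η => Ξf t y η j - η j) x ξ| ≤ C * ε * |t|) ∧
        (|deriv (fun s => mderiv2 Am Bm
            (fun y η => Xf s y η j - (y j + 2 * s * η j)) x ξ) t| ≤ C * ε ∧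
          |deriv (fun s => mderiv2 Am Bm
            (fun y η => Ξf s y η j - η j) x ξ) t| ≤ C * ε) := by
  set N : ℕ := (phaseDirs Am Bm).length with hN
  set ε₀ : ℝ := 1 / (10 * A 0) with hε₀
  have hA0 := hApos 0
  have hε₀pos : 0 < ε₀ := by positivity
  choose Kq hKq using exists_jetBound_quadPert n A
  set KF : ℕ → ℝ := fun k => ‖symplGrad n‖ * Kq (k + 1) with hKF
  obtain ⟨C, hC, hpert⟩ := exists_jetBound_perturbation (freeField n) (freeFlow n) hT hε₀pos
    (fun _ ht => norm_freeFlow_le ht) KF N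
  set D : ℝ := 1 + 2 * T + C * ε₀ * T + 1 with hD
  have hD0 : 0 ≤ D := by positivity
  set C' : ℝ := ‖freeField n‖ * (C * T) + N.factorial * |KF N| * D ^ N with hC'
  have hC'0 : 0 ≤ C' := by positivity
  refine ⟨C + C' + 1, by positivity, ?_⟩
  intro b hb hbA ε hε hεA p hp Xf Ξf hsmooth hX hΞ hX0 hΞ0 t x ξ ht hξ j
  have hbd := abs_foldr_pd_le_of_weighted hσ₀ hApos hb hbA
  have hεε : ε ≤ ε₀ := by
    rw [hε₀, le_div_iff₀ (by positivity)]
    linarith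
  set V : ℝ → Eu n × Eu n → Eu n × Eu n := fun s z => (Xf s z.1 z.2, Ξf s z.1 z.2) with hVdef
  have hVs : ContDiff ℝ (⊤ : ℕ∞) (Function.uncurry V) := hsmooth
  have hpH : ∀ y η, p y η = hamiltonian ε b (y, η) := hp
  have hV : ∀ s z, HasDerivAt (fun s => V s z)
      (symplGrad n (fderiv ℝ (hamiltonian ε b) (V s z))) s := by
    intro s z
    have hH := (differentiable_hamiltonian ε hb (V s z)).hasFDerivAt
    have hd : HasDerivAt (fun s => V s z) (deriv (fun s => V s z) s) s :=
      ((hVs.comp (contDiff_id.prodMk contDiff_const : ContDiff ℝ (⊤ : ℕ∞)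
        fun s : ℝ => (s, z))).differentiable (by simp) s).hasDerivAt
    refine hd.congr_deriv ?_
    ext i
    · have h1 := (((EuclideanSpace.proj i : Eu n →L[ℝ] ℝ).comp
        (ContinuousLinearMap.fst ℝ (Eu n) (Eu n))).hasFDerivAt.comp_hasDerivAt s hd)
      refine (h1.unique (hX s z.1 z.2 i)).trans ?_
      have h2 := (HasFDerivAt.comp (f := fun η => ((V s z).1, η)) (V s z).2 hH
        (hasFDerivAt_prodMk_right (V s z).1 (V s z).2)).fderiv
      rw [symplGrad_fst, funext (hpH (Xf s z.1 z.2))]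
      exact congrArg (fun φ => φ (EuclideanSpace.single i 1)) h2
    · have h1 := (((EuclideanSpace.proj i : Eu n →L[ℝ] ℝ).comp
        (ContinuousLinearMap.snd ℝ (Eu n) (Eu n))).hasFDerivAt.comp_hasDerivAt s hd)
      refine (h1.unique (hΞ s z.1 z.2 i)).trans ?_
      have h2 := (HasFDerivAt.comp (f := fun y => (y, (V s z).2)) (V s z).1 hH
        (hasFDerivAt_prodMk_left (V s z).1 (V s z).2)).fderiv
      rw [symplGrad_snd, funext fun y => hpH y (Ξf s z.1 z.2)]
      exact congrArg (fun φ => -φ (EuclideanSpace.single i 1)) h2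
  set F₁ : Eu n × Eu n → Eu n × Eu n := fun z => symplGrad n (fderiv ℝ (quadPert b) z) with hF₁
  have hF₁s : ContDiff ℝ (⊤ : ℕ∞) F₁ :=
    (symplGrad n).contDiff.comp (smooth_fderiv (smooth_quadPert hb))
  set Z : ℝ → Eu n × Eu n → Eu n × Eu n := fun s z => V s z - freeFlow n s z with hZdef
  have hZs : ContDiff ℝ (⊤ : ℕ∞) (Function.uncurry Z) := hVs.sub smooth_freeFlow
  have hLZ : ∀ s z, freeFlow n s z + Z s z = V s z := fun s z => by simp [hZdef]
  set R : ℝ → Eu n × Eu n → Eu n × Eu n :=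
    fun s z => freeField n (Z s z) + ε • F₁ (freeFlow n s z + Z s z) with hR
  have hode : ∀ s z, HasDerivAt (fun s => Z s z) (R s z) s := fun s z => by
    refine ((hV s z).sub (hasDerivAt_freeFlow s z)).congr_deriv ?_
    rw [symplGrad_fderiv_hamiltonian ε hb, hR]
    simp only [hLZ]
    rw [hZdef]
    simp only [map_sub, freeField_freeFlow]
    abel
  have hZ0 : ∀ z, Z 0 z = 0 := fun z => by
    simp [hZdef, hVdef, freeFlow, hX0, hΞ0]
  have hmom : ∀ s, ‖(V s (x, ξ)).2‖ ≤ 4 := norm_momentum_le hε hεA hb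
    (fun y => by simpa using hbd [] y) (fun s => hV s (x, ξ)) (by simpa [hVdef, hΞ0] using hξ)
  have hFb : ∀ s, ∀ i, JetBound i F₁ (freeFlow n s (x, ξ) + Z s (x, ξ)) (KF i) := by
    intro s i
    rw [hLZ]
    refine JetBound.clm_comp (symplGrad n) (smooth_fderiv (smooth_quadPert hb)) ?_
    refine (hKq (i + 1) b hb (fun l j k y => ?_) _ (hmom s)).fderiv
    refine le_trans ?_ (hbd l y)
    exact (Finset.single_le_sum (f := fun k => |l.foldr pd (b j k) y|)
      (fun _ _ => abs_nonneg _) (Finset.mem_univ k)).trans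
      (Finset.single_le_sum (f := fun j => ∑ k, |l.foldr pd (b j k) y|)
        (fun _ _ => Finset.sum_nonneg fun _ _ => abs_nonneg _) (Finset.mem_univ j))
  have hZb : JetBound N (Z t) (x, ξ) (C * ε * |t|) :=
    hpert F₁ ε Z (x, ξ) hε hεε hF₁s hZs hode hZ0 (fun s _ => hFb s) t ht
  have hFcomp : ContDiff ℝ (⊤ : ℕ∞) fun z => F₁ (freeFlow n t z + Z t z) :=
    hF₁s.comp ((freeFlow n t).contDiff.add (smooth_slice hZs t))
  have hRs : ContDiff ℝ (⊤ : ℕ∞) (R t) :=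
    ((freeField n).contDiff.comp (smooth_slice hZs t)).add (hFcomp.const_smul ε)
  have hRb : JetBound N (R t) (x, ξ) (C' * ε) := by
    have h1 := hZb.clm_comp (freeField n) (smooth_slice hZs t)
    have h2 := JetBound.comp_clm_add hF₁s (freeFlow n t) (smooth_slice hZs t)
      ((hFb t N).mono (le_abs_self _)) (norm_freeFlow_le ht)
      (hZb.mono (show C * ε * |t| ≤ C * ε₀ * T by gcongr))
    refine (h1.add ((freeField n).contDiff.comp (smooth_slice hZs t)) (hFcomp.const_smul ε)
      (h2.const_smul ε hFcomp)).mono ?_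
    rw [abs_of_pos hε, hC']
    have h3 : ‖freeField n‖ * (C * ε * |t|) ≤ ‖freeField n‖ * (C * ε * T) := by gcongr
    linarith
  have key : ∀ P : (Eu n × Eu n) →L[ℝ] ℝ, ‖P‖ ≤ 1 →
      |mderiv2 Am Bm (fun y η => P (Z t (y, η))) x ξ| ≤ (C + C' + 1) * ε * |t| ∧
      |deriv (fun s => mderiv2 Am Bm (fun y η => P (Z s (y, η))) x ξ) t|
        ≤ (C + C' + 1) * ε := by
    intro P hP
    have hPZ : ContDiff ℝ (⊤ : ℕ∞) (Function.uncurry fun s z => P (Z s z)) :=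
      P.contDiff.comp hZs
    have hPR : ∀ s z, HasDerivAt (fun s => P (Z s z)) (P (R s z)) s := fun s z =>
      P.hasFDerivAt.comp_hasDerivAt s (hode s z)
    have hrw : ∀ s, mderiv2 Am Bm (fun y η => P (Z s (y, η))) x ξ
        = dirDeriv (phaseDirs Am Bm) (fun z => P (Z s z)) (x, ξ) := fun s => by
      rw [mderiv2_eq_dirDeriv (smooth_slice hPZ s)]
    have hdir : ∀ (f : Eu n × Eu n → Eu n × Eu n) (c : ℝ), ContDiff ℝ (⊤ : ℕ∞) f →
        JetBound N f (x, ξ) c →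
        |dirDeriv (phaseDirs Am Bm) (fun z => P (f z)) (x, ξ)| ≤ c := by
      intro f c hf hfb
      have h1 : JetBound N (fun z => P (f z)) (x, ξ) c :=
        (hfb.clm_comp P hf).mono (mul_le_of_le_one_left hfb.nonneg hP)
      exact (JetBound.dirDeriv (k := 0) (P.contDiff.comp hf) (phaseDirs Am Bm)
        (fun v hv => norm_le_one_of_mem_phaseDirs hv) (h1.mono_order (by simp [hN]))).norm_le
    simp only [hrw]
    refine ⟨(hdir _ _ (smooth_slice hZs t) hZb).trans ?_, ?_⟩
    · gcongr
      linarith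
    · rw [((hasDerivAt_dirDeriv hPZ hPR (phaseDirs Am Bm)).2 t (x, ξ)).deriv]
      refine (hdir _ _ hRs hRb).trans ?_
      gcongr
      linarith
  have hproj : ∀ Q : (Eu n × Eu n) →L[ℝ] Eu n, ‖Q‖ ≤ 1 →
      ‖(EuclideanSpace.proj j : Eu n →L[ℝ] ℝ).comp Q‖ ≤ 1 := fun Q hQ =>
    (ContinuousLinearMap.opNorm_comp_le _ _).trans
      (mul_le_one₀ (norm_proj_le j) (norm_nonneg _) hQ)
  have hr := key _ (hproj (ContinuousLinearMap.fst ℝ _ _) (ContinuousLinearMap.norm_fst_le _ _ _))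
  have hζ := key _ (hproj (ContinuousLinearMap.snd ℝ _ _) (ContinuousLinearMap.norm_snd_le _ _ _))
  exact ⟨⟨hr.1, hζ.1⟩, hr.2, hζ.2⟩

end Paper
end
end
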